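/- arXiv:1612.08940 — 11 statements merged into one kernel-verified Lean document; each statement's English description precedes it below -/
import Mathlib

section
/- Let n ≥ 2, let B be an n×n complex Hermitian matrix, and let k be an integer with 1 ≤ k ≤ n−1. Suppose that every principal minor of B of order k is nonzero and that B has both a positive and a negative principal minor of order k. Then B has a nonzero principal minor of order k+1. (Equivalently, the subsequence A*N cannot occur in the sepr-sequence of a Hermitian matrix.) -/
/-- The principal minor of the complex matrix `B` indexed by the subset `α`
(as a real number; for Hermitian matrices all principal minors are real). -/
noncomputable def pminor {n : ℕ} (B : Matrix (Fin n) (Fin n) ℂ) (α : Finset (Fin n)) : ℝ :=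
  (Matrix.det (fun i j : α => B i j)).re

theorem Matrix.adjugate_diag_mul_diag_of_det_eq_zero {m K : Type*} [Fintype m] [DecidableEq m]
    [Field K] (M : Matrix m m K) (hM : M.det = 0) (i j : m) (hi : M.adjugate i i ≠ 0) :
    M.adjugate i i * M.adjugate j j = M.adjugate i j * M.adjugate j i := by
  set z : m → K := fun a => M.adjugate i i * M.adjugate a j - M.adjugate i j * M.adjugate a i
    with hz
  have key : ∀ a b, ∑ c, M a c * M.adjugate c b = 0 := fun a b => by
    rw [← Matrix.mul_apply, Matrix.mul_adjugate, hM, zero_smul, Matrix.zero_apply]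
  have hN : (M.updateRow i (Pi.single i 1)).mulVec z = 0 := by
    ext a
    rcases eq_or_ne a i with rfl | ha
    · simp [Matrix.mulVec, hz, mul_comm]
    · have : ∑ c, M a c * z c = M.adjugate i i * ∑ c, M a c * M.adjugate c j
          - M.adjugate i j * ∑ c, M a c * M.adjugate c i := by
        rw [Finset.mul_sum, Finset.mul_sum, ← Finset.sum_sub_distrib]
        exact Finset.sum_congr rfl fun c _ => by simp only [hz]; ring
      rw [key, key] at this
      simpa [Matrix.mulVec, dotProduct, Matrix.updateRow_ne ha] using this
  rw [Matrix.adjugate_apply] at hi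
  have := congrFun (Matrix.eq_zero_of_mulVec_eq_zero hi hN) j
  exact sub_eq_zero.mp this

theorem Matrix.adjugate_diag_eq_det_erase {n K : Type*} [DecidableEq n] [CommRing K]
    (B : Matrix n n K) (β : Finset n) (i : β) :
    (B.submatrix (fun a : β => (a : n)) fun a : β => (a : n)).adjugate i i
      = (B.submatrix (fun a : β.erase (i : n) => (a : n))
          fun a : β.erase (i : n) => (a : n)).det := by
  rw [Matrix.adjugate_apply,
    Matrix.twoBlockTriangular_det _ (fun x : β => x ≠ i) (by
      intro a ha b hb
      obtain rfl : a = i := not_not.mp ha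
      simp [hb])]
  have : Unique {x : β // ¬ x ≠ i} := ⟨⟨⟨i, by simp⟩⟩, fun x => Subtype.ext (not_not.mp x.2)⟩
  have h1 : (Matrix.toSquareBlockProp (Matrix.updateRow
      (B.submatrix (fun a : β => (a : n)) fun a : β => (a : n)) i (Pi.single i 1))
      (fun x => ¬ x ≠ i)).det = 1 := by
    rw [Matrix.det_unique]
    have hd : ((default : {x : β // ¬ x ≠ i}) : β) = i := not_not.mp (default : {x : β // ¬ x ≠ i}).2
    simp [Matrix.toSquareBlockProp_def, hd]
  rw [h1, mul_one]
  let e : {x : β // x ≠ i} ≃ β.erase (i : n) :=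
    { toFun := fun x => ⟨x.1, Finset.mem_erase.2 ⟨fun h => x.2 (Subtype.ext h), x.1.2⟩⟩
      invFun := fun x => ⟨⟨x.1, Finset.mem_of_mem_erase x.2⟩,
        fun h => Finset.ne_of_mem_erase x.2 (congrArg Subtype.val h)⟩
      left_inv := fun _ => rfl
      right_inv := fun _ => rfl }
  rw [← Matrix.det_submatrix_equiv_self e]
  congr 1
  ext a b
  simp [Matrix.toSquareBlockProp_def, Matrix.updateRow_ne a.2, e]

theorem Matrix.IsHermitian.ofReal_pminor {n : ℕ} {B : Matrix (Fin n) (Fin n) ℂ}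
    (hB : B.IsHermitian) (α : Finset (Fin n)) :
    (pminor B α : ℂ) = Matrix.det (fun i j : α => B i j) := by
  have h : Matrix.IsHermitian (fun i j : α => B i j) := hB.submatrix (fun i : α => (i : Fin n))
  rw [pminor, ← Complex.conj_eq_iff_re]
  have := Matrix.det_conjTranspose (fun i j : α => B i j)
  rw [h.eq] at this
  exact this.symm

theorem pminor_erase_pos {n : ℕ} {B : Matrix (Fin n) (Fin n) ℂ} (hB : B.IsHermitian)
    {β : Finset (Fin n)} (hβ : pminor B β = 0) {i j : Fin n} (hi : i ∈ β) (hj : j ∈ β)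
    (hpos : 0 < pminor B (β.erase i)) (hne : pminor B (β.erase j) ≠ 0) :
    0 < pminor B (β.erase j) := by
  set M : Matrix β β ℂ := fun a b => B a b with hM
  have hMh : M.IsHermitian := hB.submatrix (fun i : β => (i : Fin n))
  have hdet : M.det = 0 := by rw [hM, ← hB.ofReal_pminor, hβ, Complex.ofReal_zero]
  have hI : M.adjugate ⟨i, hi⟩ ⟨i, hi⟩ = (pminor B (β.erase i) : ℂ) := by
    rw [hB.ofReal_pminor]; exact Matrix.adjugate_diag_eq_det_erase B β ⟨i, hi⟩
  have hJ : M.adjugate ⟨j, hj⟩ ⟨j, hj⟩ = (pminor B (β.erase j) : ℂ) := by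
    rw [hB.ofReal_pminor]; exact Matrix.adjugate_diag_eq_det_erase B β ⟨j, hj⟩
  have hmul := M.adjugate_diag_mul_diag_of_det_eq_zero hdet ⟨i, hi⟩ ⟨j, hj⟩
    (by rw [hI]; exact_mod_cast hpos.ne')
  have hadj : M.adjugate ⟨j, hj⟩ ⟨i, hi⟩ = star (M.adjugate ⟨i, hi⟩ ⟨j, hj⟩) := by
    rw [← Matrix.conjTranspose_apply, Matrix.adjugate_conjTranspose, hMh.eq]
  rw [hI, hJ, hadj, Complex.star_def, Complex.mul_conj] at hmul
  have hreal : pminor B (β.erase i) * pminor B (β.erase j)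
      = Complex.normSq (M.adjugate ⟨i, hi⟩ ⟨j, hj⟩) := by exact_mod_cast hmul
  have hnonneg : 0 ≤ pminor B (β.erase j) :=
    nonneg_of_mul_nonneg_right (hreal ▸ Complex.normSq_nonneg _) hpos
  exact hnonneg.lt_of_ne' hne

/-- A property of `k`-subsets that is stable under exchanging one element holds for all
`k`-subsets as soon as it holds for one. -/
theorem Finset.forall_card_eq_of_exchange {ι : Type*} [DecidableEq ι] {k : ℕ}
    {P : Finset ι → Prop}
    (h : ∀ β : Finset ι, β.card = k + 1 → ∀ i ∈ β, ∀ j ∈ β, P (β.erase i) → P (β.erase j))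
    {α : Finset ι} (hα : α.card = k) (hP : P α) {α' : Finset ι} (hα' : α'.card = k) : P α' := by
  induction hd : (α' \ α).card generalizing α with
  | zero =>
    have hsub : α' ⊆ α := Finset.sdiff_eq_empty_iff_subset.mp (Finset.card_eq_zero.mp hd)
    rwa [Finset.eq_of_subset_of_card_le hsub (by omega)]
  | succ d ih =>
    obtain ⟨j, hj⟩ : (α' \ α).Nonempty := Finset.card_pos.mp (by omega)
    obtain ⟨i, hi⟩ : (α \ α').Nonempty := by
      have := Finset.card_sdiff_add_card_inter α α'
      have := Finset.card_sdiff_add_card_inter α' α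
      rw [Finset.inter_comm] at this
      exact Finset.card_pos.mp (by omega)
    rw [Finset.mem_sdiff] at hi hj
    have hcard : (insert j α).card = k + 1 := by rw [Finset.card_insert_of_notMem hj.2, hα]
    have hmem : i ∈ insert j α := Finset.mem_insert_of_mem hi.1
    refine ih (α := (insert j α).erase i) (by rw [Finset.card_erase_of_mem hmem]; omega)
      (h _ hcard j (Finset.mem_insert_self j α) i hmem
        (by rwa [Finset.erase_insert hj.2])) ?_
    have : α' \ (insert j α).erase i = (α' \ α).erase j := by
      ext x
      simp only [Finset.mem_sdiff, Finset.mem_erase, Finset.mem_insert]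
      have : x ∈ α' → x ≠ i := fun hx hxi => hi.2 (hxi ▸ hx)
      tauto
    rw [this, Finset.card_erase_of_mem (Finset.mem_sdiff.mpr hj)]
    omega

/-- the subsequence A*N cannot occur in the sepr-sequence of a Hermitian matrix. -/
theorem no_AstarN {n : ℕ} (hn : 2 ≤ n) (B : Matrix (Fin n) (Fin n) ℂ) (hB : B.IsHermitian)
    (k : ℕ) (hk1 : 1 ≤ k) (hk2 : k ≤ n - 1)
    (hall : ∀ α : Finset (Fin n), α.card = k → pminor B α ≠ 0)
    (hpos : ∃ α : Finset (Fin n), α.card = k ∧ 0 < pminor B α)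
    (hneg : ∃ α : Finset (Fin n), α.card = k ∧ pminor B α < 0) :
    ∃ β : Finset (Fin n), β.card = k + 1 ∧ pminor B β ≠ 0 := by
  by_contra! hzero
  obtain ⟨α, hα, hαpos⟩ := hpos
  obtain ⟨α', hα', hαneg⟩ := hneg
  refine hαneg.not_gt (Finset.forall_card_eq_of_exchange (P := fun α => 0 < pminor B α)
    (fun β hβ i hi j hj hp => ?_) hα hαpos hα')
  exact pminor_erase_pos hB (hzero β hβ) hi hj hp
    (hall _ (by rw [Finset.card_erase_of_mem hj, hβ, Nat.add_sub_cancel]))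
end

section
/- Let B be an n×n complex Hermitian matrix and let k be an integer with 1 ≤ k and k+1 ≤ n. Suppose that every principal minor of B of order k+1 is nonzero and that B has both a positive and a negative principal minor of order k+1. Then B has a nonzero principal minor of order k. (Equivalently, the subsequence NA* cannot occur in the sepr-sequence of a Hermitian matrix.) -/
open Matrix in
/-- Bordered determinant, multiplied by the determinant of the bordered matrix. -/
theorem det_fromBlocks_replicate_mul_det {R m : Type*} [CommRing R] [Fintype m] [DecidableEq m]
    (M : Matrix m m R) (u v : m → R) (a : R) :
    (fromBlocks M (replicateCol Unit u) (replicateRow Unit v) (of fun _ _ => a)).det * M.det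
      = (a * M.det - v ⬝ᵥ (M.adjugate *ᵥ u)) * M.det := by
  have key : fromBlocks M (replicateCol Unit u) (replicateRow Unit v) (of fun _ _ => a) *
      fromBlocks 1 (-replicateCol Unit (M.adjugate *ᵥ u)) 0 (of fun _ _ => M.det) =
      fromBlocks M 0 (replicateRow Unit v)
        (of fun _ _ => a * M.det - v ⬝ᵥ (M.adjugate *ᵥ u)) := by
    rw [fromBlocks_multiply]
    congr 1
    · simp
    · ext i j
      have h : (M *ᵥ (M.adjugate *ᵥ u)) i = M.det * u i := by
        rw [mulVec_mulVec, mul_adjugate, smul_mulVec, one_mulVec, Pi.smul_apply, smul_eq_mul]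
      simp only [Matrix.mul_neg, Matrix.add_apply, Matrix.neg_apply, mul_apply, replicateCol_apply, of_apply,
        Finset.univ_unique, Finset.sum_const, Finset.card_singleton, one_smul, Matrix.zero_apply]
      simp only [mulVec, dotProduct] at h ⊢
      rw [h]; ring
    · simp
    · ext i j
      simp only [Matrix.mul_neg, Matrix.add_apply, Matrix.neg_apply, mul_apply, replicateCol_apply, of_apply,
        Finset.univ_unique, Finset.sum_const, Finset.card_singleton, one_smul, replicateRow_apply,
        dotProduct]
      ring
  have h := congrArg det key
  rw [det_mul, det_fromBlocks_zero₂₁, det_fromBlocks_zero₁₂] at h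
  simp only [det_one, det_unique, of_apply, one_mul] at h
  rw [h, mul_comm]

open Matrix Polynomial in
/-- Cauchy's expansion of a bordered determinant. -/
theorem det_fromBlocks_replicate {R m : Type*} [CommRing R] [Fintype m] [DecidableEq m]
    (M : Matrix m m R) (u v : m → R) (a : R) :
    (fromBlocks M (replicateCol Unit u) (replicateRow Unit v) (of fun _ _ => a)).det
      = a * M.det - v ⬝ᵥ (M.adjugate *ᵥ u) := by
  let M' : Matrix m m R[X] := M.map C + (X : R[X]) • (1 : Matrix m m R[X])
  let f : R[X] →+* R := evalRingHom 0
  have hM : f.mapMatrix M' = M := by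
    ext i j
    simp [M', f, one_apply, apply_ite]
  have hreg : IsRightRegular M'.det := by
    have h : M' = (X : R[X]) • (1 : Matrix m m R[X]) + M.map C := add_comm _ _
    rw [h]
    refine Polynomial.Monic.isRegular ?_ |>.right
    simp only [Polynomial.Monic.def, ← Polynomial.leadingCoeff_det_X_one_add_C M]
  have h := congrArg f (hreg (det_fromBlocks_replicate_mul_det M' (C ∘ u) (C ∘ v) (C a)))
  have hu : (f ∘ (C ∘ u)) = u := by ext; simp [f]
  have hv : (f ∘ (C ∘ v)) = v := by ext; simp [f]
  have ha : f (C a) = a := by simp [f]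
  have hfrom : f.mapMatrix (fromBlocks M' (replicateCol Unit (C ∘ u)) (replicateRow Unit (C ∘ v))
      (of fun _ _ => C a)) =
      fromBlocks M (replicateCol Unit u) (replicateRow Unit v) (of fun _ _ => a) := by
    rw [RingHom.mapMatrix_apply, fromBlocks_map]
    congr 1
    · ext i j; simp [f]
    · ext i j; simp [f]
    · ext i j; simp [f]
  rw [RingHom.map_det, hfrom, map_sub, map_mul, RingHom.map_det, hM, ha, RingHom.map_dotProduct,
    hv] at h
  rw [h]
  congr 2
  ext i
  rw [Function.comp_apply, RingHom.map_mulVec, hu, ← RingHom.mapMatrix_apply,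
    RingHom.map_adjugate, hM]

open Matrix ComplexOrder in
/-- If `M` is Hermitian and singular, and `M` bordered by `u` is nonsingular, then the values of
the form of `M.adjugate` at `u` and at `w` have nonnegative product. -/
theorem adjugate_form_mul_nonneg {m : Type*} [Fintype m] [DecidableEq m]
    (M : Matrix m m ℂ) (hM : M.IsHermitian) (hdet : M.det = 0) (u w : m → ℂ) (a : ℂ)
    (hu : (fromBlocks M (replicateCol Unit u) (replicateRow Unit (star u))
      (of fun _ _ => a)).det ≠ 0) :
    0 ≤ (star u ⬝ᵥ (M.adjugate *ᵥ u)) * (star w ⬝ᵥ (M.adjugate *ᵥ w)) := by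
  set x := M.adjugate *ᵥ u with hx
  set y := M.adjugate *ᵥ w with hy
  have hker (t : m → ℂ) : M *ᵥ (M.adjugate *ᵥ t) = 0 := by
    rw [mulVec_mulVec, mul_adjugate, hdet, zero_smul, zero_mulVec]
  have hz : (star u ⬝ᵥ y) • x - (star u ⬝ᵥ x) • y = 0 := by
    set z := (star u ⬝ᵥ y) • x - (star u ⬝ᵥ x) • y with hzdef
    have h0 : fromBlocks M (replicateCol Unit u) (replicateRow Unit (star u))
        (of fun _ _ => a) *ᵥ (Sum.elim z 0) = 0 := by
      have h1 : M *ᵥ z = 0 := by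
        rw [hzdef, mulVec_sub, mulVec_smul, mulVec_smul, hker, hker]; simp
      have h2 : star u ⬝ᵥ z = 0 := by
        rw [hzdef, dotProduct_sub, dotProduct_smul, dotProduct_smul]
        simp only [smul_eq_mul]; ring
      rw [fromBlocks_mulVec]
      ext (i | i)
      · simp [h1]
      · simpa [mulVec, replicateRow, Pi.star_def] using h2
    have h3 := eq_zero_of_mulVec_eq_zero hu h0
    ext i
    exact congrFun h3 (Sum.inl i)
  have hprod : (star u ⬝ᵥ x) * (star w ⬝ᵥ y) = (star u ⬝ᵥ y) * (star w ⬝ᵥ x) := by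
    have := congrArg (star w ⬝ᵥ ·) hz
    simp only [dotProduct_sub, dotProduct_smul, smul_eq_mul, dotProduct_zero] at this
    exact (sub_eq_zero.mp this).symm
  have hstar : star w ⬝ᵥ x = star (star u ⬝ᵥ y) := by
    rw [star_dotProduct, hx, hy, star_mulVec, hM.adjugate.eq, dotProduct_mulVec]
  rw [hprod, hstar]
  exact mul_star_self_nonneg _

open Matrix in
/-- The principal submatrix on `insert i S` is the one on `S` bordered by the `i`-th column. -/
theorem det_submatrix_insert {n : ℕ} (B : Matrix (Fin n) (Fin n) ℂ) (hB : B.IsHermitian)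
    {S : Finset (Fin n)} {i : Fin n} (hi : i ∉ S) :
    (B.submatrix (Subtype.val : ↥(insert i S) → Fin n) Subtype.val).det =
      (fromBlocks (B.submatrix (Subtype.val : S → Fin n) Subtype.val) (replicateCol Unit fun p : S => B p i)
        (replicateRow Unit (star fun p : S => B p i)) (of fun _ _ => B i i)).det := by
  let e := (Finset.subtypeInsertEquivOption hi).trans (Equiv.optionEquivSumPUnit.{0} ↥S)
  rw [← det_submatrix_equiv_self e.symm]
  congr 1
  ext (p | p) (q | q)
  · rfl
  · rfl
  · exact (hB.apply i q).symm
  · rfl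

open Matrix ComplexOrder in
/-- If the principal minor on `S` vanishes, nonzero principal minors on one-element extensions
of `S` share their sign. -/
theorem pminor_insert_pos {n : ℕ} (B : Matrix (Fin n) (Fin n) ℂ) (hB : B.IsHermitian)
    {S : Finset (Fin n)} (hS : pminor B S = 0) {i j : Fin n} (hi : i ∉ S) (hj : j ∉ S)
    (hpos : 0 < pminor B (insert i S)) (hne : pminor B (insert j S) ≠ 0) :
    0 < pminor B (insert j S) := by
  have herm (T : Finset (Fin n)) : IsHermitian (B.submatrix (Subtype.val : T → Fin n) Subtype.val) :=
    hB.submatrix Subtype.val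
  have him (T : Finset (Fin n)) : (B.submatrix (Subtype.val : T → Fin n) Subtype.val).det.im = 0 := by
    apply Complex.conj_eq_iff_im.mp
    have h := (herm T).eq
    have h' := congrArg det h
    rw [det_conjTranspose] at h'
    exact h'
  have hdet : (B.submatrix (Subtype.val : S → Fin n) Subtype.val).det = 0 := Complex.ext hS (him S)
  have hnz : (B.submatrix (Subtype.val : ↥(insert i S) → Fin n) Subtype.val).det ≠ 0 := by
    intro h
    exact hpos.ne' (congrArg Complex.re h)
  rw [det_submatrix_insert B hB hi] at hnz
  have h := adjugate_form_mul_nonneg _ (herm S) hdet _ (fun p : S => B p j) _ hnz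
  have hmul : 0 ≤ (B.submatrix (Subtype.val : ↥(insert i S) → Fin n) Subtype.val).det *
      (B.submatrix (Subtype.val : ↥(insert j S) → Fin n) Subtype.val).det := by
    rw [det_submatrix_insert B hB hi, det_submatrix_insert B hB hj, det_fromBlocks_replicate,
      det_fromBlocks_replicate, hdet]
    simpa using h
  have hre := (Complex.le_def.mp hmul).1
  rw [Complex.mul_re, him, him, Complex.zero_re, mul_zero, sub_zero] at hre
  exact lt_of_le_of_ne (nonneg_of_mul_nonneg_right hre hpos) hne.symm

theorem pminor_pos_of_pos {n : ℕ} (B : Matrix (Fin n) (Fin n) ℂ) (hB : B.IsHermitian) (k : ℕ)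
    (hall : ∀ α : Finset (Fin n), α.card = k + 1 → pminor B α ≠ 0)
    (hzero : ∀ β : Finset (Fin n), β.card = k → pminor B β = 0)
    {α β : Finset (Fin n)} (hα : α.card = k + 1) (hβ : β.card = k + 1)
    (hpos : 0 < pminor B α) : 0 < pminor B β := by
  induction hd : (α \ β).card using Nat.strong_induction_on generalizing α with
  | _ d ih =>
    rcases (α \ β).eq_empty_or_nonempty with h | ⟨a, ha⟩
    · rwa [← Finset.eq_of_subset_of_card_le (Finset.sdiff_eq_empty_iff_subset.mp h)
        (by rw [hα, hβ])]
    · have hcard : (β \ α).card = (α \ β).card := Finset.card_sdiff_comm (hβ.trans hα.symm)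
      obtain ⟨b, hb⟩ : (β \ α).Nonempty := by
        rw [← Finset.card_pos, hcard]
        exact Finset.card_pos.mpr ⟨a, ha⟩
      have ha' := Finset.mem_sdiff.mp ha
      have hb' := Finset.mem_sdiff.mp hb
      have hS : (α.erase a).card = k := by
        rw [Finset.card_erase_of_mem ha'.1, hα, Nat.add_sub_cancel]
      have hbS : b ∉ α.erase a := fun h => hb'.2 (Finset.mem_of_mem_erase h)
      have hcard' : (insert b (α.erase a)).card = k + 1 := by
        rw [Finset.card_insert_of_notMem hbS, hS]
      refine ih _ ?_ hcard' ?_ rfl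
      · rw [← hd]
        apply Finset.card_lt_card
        refine ⟨fun c hc => ?_, fun h => ?_⟩
        · grind
        · have := h ha
          grind
      · exact pminor_insert_pos B hB (hzero _ hS) (Finset.notMem_erase a α) hbS
          (by rwa [Finset.insert_erase ha'.1]) (hall _ hcard')

/-- the subsequence NA* cannot occur in the sepr-sequence of a Hermitian matrix. -/
theorem no_NAstar {n : ℕ} (B : Matrix (Fin n) (Fin n) ℂ) (hB : B.IsHermitian)
    (k : ℕ) (hk1 : 1 ≤ k) (hk2 : k + 1 ≤ n)
    (hall : ∀ α : Finset (Fin n), α.card = k + 1 → pminor B α ≠ 0)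
    (hpos : ∃ α : Finset (Fin n), α.card = k + 1 ∧ 0 < pminor B α)
    (hneg : ∃ α : Finset (Fin n), α.card = k + 1 ∧ pminor B α < 0) :
    ∃ β : Finset (Fin n), β.card = k ∧ pminor B β ≠ 0 := by
  by_contra! hzero
  obtain ⟨α, hα, hαpos⟩ := hpos
  obtain ⟨β, hβ, hβneg⟩ := hneg
  exact hβneg.not_gt (pminor_pos_of_pos B hB k hall hzero hα hβ hαpos)
end

section
/- Let B be an n×n complex Hermitian matrix, let k be an integer with 1 ≤ k ≤ n−2, and let ε ∈ {1, −1}. Suppose ε·det B[α] > 0 for every subset α of size k, and ε·det B[β] > 0 for every subset β of size k+2. Then there exists δ ∈ {1, −1} such that δ·det B[γ] > 0 for every subset γ of size k+1. (Equivalently, if A⁺XA⁺ or A⁻XA⁻ occurs in the sepr-sequence of a Hermitian matrix, then X ∈ {A⁺, A⁻}.) -/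
open Matrix in
/-- The principal minor on the range of an injective indexing map, as a complex number. -/
theorem det_submatrix_eq_pminor {n : ℕ} {B : Matrix (Fin n) (Fin n) ℂ} (hB : B.IsHermitian)
    {ι : Type*} [Fintype ι] [DecidableEq ι] {f : ι → Fin n} (hf : Function.Injective f)
    {γ : Finset (Fin n)} (hγ : ∀ x, x ∈ γ ↔ ∃ a, f a = x) :
    (B.submatrix f f).det = (pminor B γ : ℂ) := by
  let e : ι ≃ γ := Equiv.ofBijective (fun a => ⟨f a, (hγ _).2 ⟨a, rfl⟩⟩)
    ⟨fun a b h => hf (congrArg Subtype.val h), fun x => by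
      obtain ⟨a, ha⟩ := (hγ x).1 x.2
      exact ⟨a, Subtype.ext ha⟩⟩
  have hdet : (B.submatrix f f).det = (Matrix.det (fun i j : γ => B i j)) :=
    det_submatrix_equiv_self e (B.submatrix Subtype.val Subtype.val)
  have hreal : star (B.submatrix f f).det = (B.submatrix f f).det := by
    rw [← det_conjTranspose, (hB.submatrix f).eq]
  rw [pminor, ← hdet]
  exact (Complex.conj_eq_iff_re.1 hreal).symm

/-- The Schur complement of `B[α]`, with rows and columns indexed by all of `Fin n`. -/
noncomputable def schurCompl {n : ℕ} (B : Matrix (Fin n) (Fin n) ℂ) (α : Finset (Fin n)) :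
    Matrix (Fin n) (Fin n) ℂ :=
  let v : α → Fin n := Subtype.val
  B - B.submatrix (id : Fin n → Fin n) v * (B.submatrix v v)⁻¹ * B.submatrix v (id : Fin n → Fin n)

open Matrix in
theorem schurCompl_isHermitian {n : ℕ} {B : Matrix (Fin n) (Fin n) ℂ} (hB : B.IsHermitian)
    (α : Finset (Fin n)) : (schurCompl B α).IsHermitian := by
  unfold schurCompl
  refine hB.sub ?_
  rw [IsHermitian, conjTranspose_mul, conjTranspose_mul, conjTranspose_nonsing_inv,
    conjTranspose_submatrix, conjTranspose_submatrix, conjTranspose_submatrix, hB.eq,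
    Matrix.mul_assoc]

open Matrix in
theorem pminor_eq_mul_det_schurCompl {n : ℕ} {B : Matrix (Fin n) (Fin n) ℂ}
    (hB : B.IsHermitian) {α γ : Finset (Fin n)} (hα : pminor B α ≠ 0)
    {κ : Type*} [Fintype κ] [DecidableEq κ] {g : κ → Fin n} (hg : Function.Injective g)
    (hgα : ∀ a, g a ∉ α) (hγ : ∀ x, x ∈ γ ↔ x ∈ α ∨ ∃ a, g a = x) :
    (pminor B γ : ℂ) = pminor B α * ((schurCompl B α).submatrix g g).det := by
  have hA : (B.submatrix (Subtype.val : α → Fin n) Subtype.val).det = (pminor B α : ℂ) :=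
    det_submatrix_eq_pminor hB Subtype.val_injective (by simp)
  have hinj : Function.Injective (Sum.elim (Subtype.val : α → Fin n) g) :=
    Subtype.val_injective.sumElim hg fun a b h => hgα b (h ▸ a.2)
  rw [← det_submatrix_eq_pminor (γ := γ) hB hinj (by simp [hγ]), ← hA]
  let : Invertible (B.submatrix (Subtype.val : α → Fin n) Subtype.val) :=
    invertibleOfIsUnitDet _ (by rw [hA]; simpa using hα)
  have hblocks : B.submatrix (Sum.elim (Subtype.val : α → Fin n) g)
      (Sum.elim (Subtype.val : α → Fin n) g) =
      fromBlocks (B.submatrix Subtype.val Subtype.val) (B.submatrix Subtype.val g)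
        (B.submatrix g Subtype.val) (B.submatrix g g) := by
    ext (i | i) (j | j) <;> rfl
  rw [hblocks, det_fromBlocks₁₁, invOf_eq_nonsing_inv]
  rfl

theorem pminor_insert_mul_pminor_insert_pos {n : ℕ} {B : Matrix (Fin n) (Fin n) ℂ}
    (hB : B.IsHermitian) {α : Finset (Fin n)} {i j : Fin n} (hi : i ∉ α) (hj : j ∉ α)
    (hij : i ≠ j) (h : 0 < pminor B α * pminor B (insert i (insert j α))) :
    0 < pminor B (insert i α) * pminor B (insert j α) := by
  have hα : pminor B α ≠ 0 := left_ne_zero_of_mul h.ne'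
  have hsingle (l : Fin n) (hl : l ∉ α) :
      (pminor B (insert l α) : ℂ) = pminor B α * schurCompl B α l l := by
    rw [pminor_eq_mul_det_schurCompl hB hα (g := fun _ : Unit => l)
      (Function.injective_of_subsingleton _) (fun _ => hl) (by simp [eq_comm, or_comm])]
    simp
  have hpair := pminor_eq_mul_det_schurCompl (γ := insert i (insert j α)) hB hα (g := ![i, j])
    (by intro a b; fin_cases a <;> fin_cases b <;> simp [hij, hij.symm])
    (by intro a; fin_cases a <;> simpa)
    (by intro x; simp [Fin.exists_fin_two]; tauto)
  have hconj : schurCompl B α i j * schurCompl B α j i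
      = (Complex.normSq (schurCompl B α i j) : ℂ) := by
    rw [← (schurCompl_isHermitian hB α).apply j i, ← Complex.mul_conj]
    rfl
  rw [Matrix.det_fin_two] at hpair
  simp only [Matrix.submatrix_apply, Matrix.cons_val_zero, Matrix.cons_val_one] at hpair
  rw [hconj] at hpair
  have key : pminor B (insert i α) * pminor B (insert j α) =
      pminor B α * pminor B (insert i (insert j α)) +
        pminor B α ^ 2 * Complex.normSq (schurCompl B α i j) := by
    apply Complex.ofReal_injective
    push_cast
    rw [hpair, hsingle i hi, hsingle j hj]
    ring
  rw [key]
  have := Complex.normSq_nonneg (schurCompl B α i j)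
  positivity

/-- A function on the subsets of size `k + 1` whose values at any two sets differing by one
exchange have the same strict sign has constant strict sign. -/
theorem mul_pos_of_exchange {V : Type*} [Fintype V] [DecidableEq V] {k : ℕ}
    (hk : k + 1 < Fintype.card V) {p : Finset V → ℝ}
    (hp : ∀ (α : Finset V) (i j : V), α.card = k → i ∉ α → j ∉ α → i ≠ j →
      0 < p (insert i α) * p (insert j α))
    {γ γ' : Finset V} (hγ : γ.card = k + 1) (hγ' : γ'.card = k + 1) : 0 < p γ * p γ' := by
  have hexch {γ : Finset V} (hγ : γ.card = k + 1) {i j : V} (hi : i ∈ γ) (hj : j ∉ γ) :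
      0 < p γ * p (insert j (γ.erase i)) := by
    have := hp (γ.erase i) i j (by rw [Finset.card_erase_of_mem hi, hγ]; rfl)
      (by simp) (by simp [hj]) (by rintro rfl; exact hj hi)
    rwa [Finset.insert_erase hi] at this
  induction hm : (γ \ γ').card generalizing γ with
  | zero =>
    obtain rfl : γ = γ' := Finset.eq_of_subset_of_card_le
      (Finset.sdiff_eq_empty_iff_subset.1 (Finset.card_eq_zero.1 hm)) (by omega)
    obtain ⟨i, hi⟩ := Finset.card_pos.1 (by omega : 0 < γ.card)
    obtain ⟨j, hj⟩ : ∃ j, j ∉ γ := by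
      by_contra! hall
      have := Finset.card_eq_iff_eq_univ γ |>.2 (Finset.eq_univ_of_forall hall)
      omega
    exact mul_self_pos.2 (left_ne_zero_of_mul (hexch hγ hi hj).ne')
  | succ m ih =>
    have hm' : (γ' \ γ).card = m + 1 := by
      rw [← hm]
      exact Finset.card_sdiff_comm (by omega)
    obtain ⟨i, hi⟩ := Finset.card_pos.1 (by omega : 0 < (γ \ γ').card)
    obtain ⟨j, hj⟩ := Finset.card_pos.1 (by omega : 0 < (γ' \ γ).card)
    rw [Finset.mem_sdiff] at hi hj
    have hcard : (insert j (γ.erase i)).card = k + 1 := by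
      rw [Finset.card_insert_of_notMem (by simp [hj.2]), Finset.card_erase_of_mem hi.1, hγ]
      rfl
    have hdiff : insert j (γ.erase i) \ γ' = (γ \ γ').erase i := by
      rw [Finset.insert_sdiff_of_mem _ hj.1, Finset.erase_sdiff_comm]
    have h₁ := hexch hγ hi.1 hj.2
    have h₂ := ih hcard (by
      rw [hdiff, Finset.card_erase_of_mem (Finset.mem_sdiff.2 hi), hm]; rfl)
    rcases mul_pos_iff.1 h₁ with ⟨_, _⟩ | ⟨_, _⟩ <;>
      rcases mul_pos_iff.1 h₂ with ⟨_, _⟩ | ⟨_, _⟩ <;>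
      first
        | exact mul_pos ‹_› ‹_›
        | exact mul_pos_of_neg_of_neg ‹_› ‹_›
        | linarith

/-- if A⁺XA⁺ or A⁻XA⁻ occurs in the sepr-sequence of a Hermitian matrix,
then X ∈ {A⁺, A⁻}. -/
theorem AXA {n : ℕ} (B : Matrix (Fin n) (Fin n) ℂ) (hB : B.IsHermitian)
    (k : ℕ) (hk1 : 1 ≤ k) (hk2 : k ≤ n - 2) (ε : ℝ) (hε : ε = 1 ∨ ε = -1)
    (hk' : ∀ α : Finset (Fin n), α.card = k → 0 < ε * pminor B α)
    (hk2' : ∀ β : Finset (Fin n), β.card = k + 2 → 0 < ε * pminor B β) :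
    ∃ δ : ℝ, (δ = 1 ∨ δ = -1) ∧
      ∀ γ : Finset (Fin n), γ.card = k + 1 → 0 < δ * pminor B γ := by
  have hpos {γ γ' : Finset (Fin n)} (hγ : γ.card = k + 1) (hγ' : γ'.card = k + 1) :
      0 < pminor B γ * pminor B γ' := by
    refine mul_pos_of_exchange (by rw [Fintype.card_fin]; omega) ?_ hγ hγ'
    intro α i j hα hi hj hij
    refine pminor_insert_mul_pminor_insert_pos hB hi hj hij ?_
    have h₁ := hk' α hα
    have h₂ := hk2' (insert i (insert j α)) (by
      rw [Finset.card_insert_of_notMem (by simp [hij, hi]), Finset.card_insert_of_notMem hj, hα])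
    have hsq : ε * ε = 1 := by rcases hε with rfl | rfl <;> norm_num
    have := mul_pos h₁ h₂
    rwa [mul_mul_mul_comm, hsq, one_mul] at this
  by_cases h : ∃ γ : Finset (Fin n), γ.card = k + 1 ∧ 0 < pminor B γ
  · obtain ⟨γ, hγ, hγpos⟩ := h
    exact ⟨1, Or.inl rfl, fun γ' hγ' => by
      rw [one_mul]; exact (mul_pos_iff_of_pos_left hγpos).1 (hpos hγ hγ')⟩
  · push Not at h
    refine ⟨-1, Or.inr rfl, fun γ hγ => ?_⟩
    have := lt_of_le_of_ne (h γ hγ) (left_ne_zero_of_mul (hpos hγ hγ).ne')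
    linarith
end

section
/- Let B be an n×n complex Hermitian matrix, let k be an integer with 1 ≤ k ≤ n−2, and let ε ∈ {1, −1}. Suppose: ε·det B[α] ≥ 0 for every subset α of size k; there exist subsets α₀ and α₁ of size k with det B[α₀] = 0 and det B[α₁] ≠ 0; and ε·det B[β] > 0 for every subset β of size k+2. Then there exists δ ∈ {1, −1} such that δ·det B[γ] > 0 for every subset γ of size k+1. (Equivalently, if S⁺XA⁺ or S⁻XA⁻ occurs in the sepr-sequence of a Hermitian matrix, then X ∈ {A⁺, A⁻}.) -/
open Matrix in
/-- Jacobi's complementary minor identity for principal minors. -/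
theorem Matrix.det_mul_det_inv_toSquareBlockProp {ι R : Type*} [Fintype ι] [DecidableEq ι]
    [CommRing R] (M : Matrix ι ι R) (hM : IsUnit M.det) (p : ι → Prop) [DecidablePred p] :
    M.det * (toSquareBlockProp M⁻¹ fun i => ¬p i).det = (toSquareBlockProp M p).det := by
  set E : Matrix ι ι R := of fun i j => if p j then (1 : Matrix ι ι R) i j else M⁻¹ i j with hE
  have hME : ∀ i j, (M * E) i j = if p j then M i j else (1 : Matrix ι ι R) i j := by
    intro i j
    by_cases hj : p j
    · have : (M * E) i j = (M * (1 : Matrix ι ι R)) i j := by simp only [Matrix.mul_apply, hE, of_apply, hj, if_true]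
      rw [this, mul_one, if_pos hj]
    · have : (M * E) i j = (M * M⁻¹) i j := by simp only [Matrix.mul_apply, hE, of_apply, hj, if_false]
      rw [this, mul_nonsing_inv _ hM, if_neg hj]
  have hdetE : E.det = (toSquareBlockProp M⁻¹ fun i => ¬p i).det := by
    rw [twoBlockTriangular_det E p]
    · have h1 : toSquareBlockProp E p = 1 := by
        ext i j
        simp [toSquareBlockProp_def, hE, j.2, one_apply, Subtype.ext_iff]
      have h2 : (toSquareBlockProp E fun i => ¬p i) = toSquareBlockProp M⁻¹ fun i => ¬p i := by
        ext i j
        simp [toSquareBlockProp_def, hE, j.2]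
      rw [h1, h2, det_one, one_mul]
    · intro i hi j hj
      have hij : i ≠ j := fun h => hi (h ▸ hj)
      simp [hE, hj, hij]
  have hdetME : (M * E).det = (toSquareBlockProp M p).det := by
    rw [twoBlockTriangular_det' (M * E) p]
    · have h1 : toSquareBlockProp (M * E) p = toSquareBlockProp M p := by
        ext i j
        simp [toSquareBlockProp_def, hME, j.2]
      have h2 : (toSquareBlockProp (M * E) fun i => ¬p i) = 1 := by
        ext i j
        simp [toSquareBlockProp_def, hME, j.2, one_apply, Subtype.ext_iff]
      rw [h1, h2, det_one, mul_one]
    · intro i hi j hj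
      have hij : i ≠ j := fun h => hj (h ▸ hi)
      simp [hME, hj, hij]
  rw [← hdetE, ← hdetME, det_mul]

/-- If all principal minors of order two of an invertible Hermitian matrix are nonnegative, then
its diagonal entries are nonzero and share the same sign. -/
theorem Matrix.IsHermitian.diag_mul_diag_pos {ι : Type*} [Fintype ι] [DecidableEq ι]
    {C : Matrix ι ι ℂ} (hC : C.IsHermitian) (hdet : C.det ≠ 0)
    (hminor : ∀ i j, i ≠ j → 0 ≤ (C i i * C j j - C i j * C j i).re) (i j : ι) :
    0 < (C i i).re * (C j j).re := by
  have him : ∀ i, (C i i).im = 0 := fun i => by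
    have := congrArg Complex.im (hC.apply i i)
    simp at this
    linarith
  have hre : ∀ i j, (C i i * C j j - C i j * C j i).re =
      (C i i).re * (C j j).re - Complex.normSq (C i j) := fun i j => by
    rw [← hC.apply j i]
    simp [Complex.normSq_apply, him]
  have hprod : ∀ i j, i ≠ j → Complex.normSq (C i j) ≤ (C i i).re * (C j j).re :=
    fun i j hij => by
      have := hminor i j hij
      rw [hre] at this
      linarith
  have hne : ∀ i, (C i i).re ≠ 0 := by
    intro i hi
    refine hdet (Matrix.det_eq_zero_of_row_eq_zero i fun j => ?_)
    rcases eq_or_ne i j with rfl | hij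
    · exact Complex.ext hi (him i)
    · have := hprod i j hij
      rw [hi, zero_mul] at this
      exact Complex.normSq_eq_zero.1 (le_antisymm this (Complex.normSq_nonneg _))
  rcases eq_or_ne i j with rfl | hij
  · exact mul_self_pos.2 (hne i)
  · exact lt_of_le_of_ne ((Complex.normSq_nonneg _).trans (hprod i j hij))
      (mul_ne_zero (hne i) (hne j)).symm

section PrincipalMinors

variable {n : ℕ} {B : Matrix (Fin n) (Fin n) ℂ}

theorem pminor_eq_det (hB : B.IsHermitian) (α : Finset (Fin n)) :
    (pminor B α : ℂ) = (B.submatrix ((↑) : α → Fin n) (↑)).det := by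
  have h : star (B.submatrix ((↑) : α → Fin n) (↑)).det =
      (B.submatrix ((↑) : α → Fin n) (↑)).det := by
    rw [← Matrix.det_conjTranspose, (hB.submatrix _).eq]
  exact Complex.conj_eq_iff_re.1 h

theorem det_toSquareBlockProp_mem {α β : Finset (Fin n)} (h : α ⊆ β) :
    (Matrix.toSquareBlockProp (B.submatrix ((↑) : β → Fin n) (↑)) fun i => (i : Fin n) ∈ α).det =
      (B.submatrix ((↑) : α → Fin n) (↑)).det := by
  rw [← Matrix.det_submatrix_equiv_self (Equiv.subtypeSubtypeEquivSubtype fun {_} hx => h hx)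
    (B.submatrix ((↑) : α → Fin n) (↑))]
  rfl

/-- A principal minor contained in a nonsingular principal submatrix, expressed through the
complementary minor of the inverse. -/
theorem pminor_eq_mul_det_inv (hB : B.IsHermitian) {α β : Finset (Fin n)} (h : α ⊆ β)
    (hβ : pminor B β ≠ 0) :
    pminor B α = pminor B β * (Matrix.toSquareBlockProp (B.submatrix ((↑) : β → Fin n) (↑))⁻¹
      fun i => ¬(i : Fin n) ∈ α).det.re := by
  have hu : IsUnit (B.submatrix ((↑) : β → Fin n) (↑)).det := by
    rw [← pminor_eq_det hB, isUnit_iff_ne_zero]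
    exact_mod_cast hβ
  have key := Matrix.det_mul_det_inv_toSquareBlockProp _ hu fun i : β => (i : Fin n) ∈ α
  rw [det_toSquareBlockProp_mem h, ← pminor_eq_det hB, ← pminor_eq_det hB] at key
  have := congrArg Complex.re key
  rw [Complex.re_ofReal_mul, Complex.ofReal_re] at this
  exact this.symm

theorem pminor_erase (hB : B.IsHermitian) {β : Finset (Fin n)} (hβ : pminor B β ≠ 0) (i : β) :
    pminor B (β.erase i) =
      pminor B β * ((B.submatrix ((↑) : β → Fin n) (↑))⁻¹ i i).re := by
  rw [pminor_eq_mul_det_inv hB (Finset.erase_subset _ _) hβ]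
  let _ : Unique {j : β // ¬(j : Fin n) ∈ β.erase i} :=
    { default := ⟨i, by simp⟩
      uniq := fun j => by
        have := j.2
        simp only [Finset.mem_erase, j.1.2, and_true, not_not] at this
        exact Subtype.ext (Subtype.ext this) }
  rw [Matrix.det_unique]
  rfl

theorem pminor_erase_erase (hB : B.IsHermitian) {β : Finset (Fin n)} (hβ : pminor B β ≠ 0)
    {i j : β} (hij : i ≠ j) {C : Matrix β β ℂ}
    (hC : C = (B.submatrix ((↑) : β → Fin n) (↑))⁻¹) :
    pminor B ((β.erase i).erase j) =
      pminor B β * (C i i * C j j - C i j * C j i).re := by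
  rw [pminor_eq_mul_det_inv hB ((Finset.erase_subset _ _).trans (Finset.erase_subset _ _)) hβ,
    ← hC]
  let f : Fin 2 → {l : β // ¬(l : Fin n) ∈ (β.erase i).erase j} :=
    ![⟨i, by simp⟩, ⟨j, by simp⟩]
  have hf : Function.Bijective f := by
    constructor
    · intro a b
      fin_cases a <;> fin_cases b <;> simp [f, hij, hij.symm]
    · rintro ⟨l, hl⟩
      simp only [Finset.mem_erase, l.2, and_true, not_and_or, not_not] at hl
      rcases hl with hl | hl
      · exact ⟨1, Subtype.ext (Subtype.ext hl.symm)⟩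
      · exact ⟨0, Subtype.ext (Subtype.ext hl.symm)⟩
  rw [← Matrix.det_submatrix_equiv_self (Equiv.ofBijective f hf), Matrix.det_fin_two]
  rfl

/-- If the principal minors of order `k` of a Hermitian matrix have the weak sign `ε` and the
minor on `β` of order `k + 2` has the strict sign `ε`, then the minors of order `k + 1` inside
`β` are nonzero and share the same sign. -/
theorem pminor_erase_mul_pminor_erase_pos (hB : B.IsHermitian) {k : ℕ} {ε : ℝ}
    (hnonneg : ∀ α : Finset (Fin n), α.card = k → 0 ≤ ε * pminor B α)
    {β : Finset (Fin n)} (hcard : β.card = k + 2) (hβ : 0 < ε * pminor B β)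
    {i j : Fin n} (hi : i ∈ β) (hj : j ∈ β) :
    0 < pminor B (β.erase i) * pminor B (β.erase j) := by
  have hβ0 : pminor B β ≠ 0 := right_ne_zero_of_mul hβ.ne'
  have hdet : (B.submatrix ((↑) : β → Fin n) (↑)).det ≠ 0 := by
    rw [← pminor_eq_det hB]
    exact_mod_cast hβ0
  have hdet' : ((B.submatrix ((↑) : β → Fin n) (↑))⁻¹).det ≠ 0 :=
    ((Matrix.isUnit_nonsing_inv_det_iff).2 (isUnit_iff_ne_zero.2 hdet)).ne_zero
  have hpos := (hB.submatrix ((↑) : β → Fin n)).inv.diag_mul_diag_pos hdet'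
    (fun a b hab => by
      have hc : ((β.erase a).erase b).card = k := by
        rw [Finset.card_erase_of_mem (Finset.mem_erase.2
          ⟨fun h => hab (Subtype.ext h.symm), b.2⟩), Finset.card_erase_of_mem a.2, hcard]
        rfl
      have h := hnonneg _ hc
      rw [pminor_erase_erase hB hβ0 hab rfl, ← mul_assoc] at h
      exact nonneg_of_mul_nonneg_right h hβ) ⟨i, hi⟩ ⟨j, hj⟩
  have h1 := pminor_erase hB hβ0 ⟨i, hi⟩
  have h2 := pminor_erase hB hβ0 ⟨j, hj⟩
  rw [h1, h2, mul_mul_mul_comm]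
  exact mul_pos (mul_self_pos.2 hβ0) hpos

end PrincipalMinors

/-- A function on the `m`-subsets of a type whose sign agrees on any two subsets obtained by
erasing one element from a common `(m + 1)`-subset has constant sign. -/
theorem Finset.mul_pos_of_erase_mul_erase_pos {ι : Type*} [DecidableEq ι] {m : ℕ}
    (f : Finset ι → ℝ) (hne : ∀ s : Finset ι, s.card = m → f s ≠ 0)
    (h : ∀ t : Finset ι, t.card = m + 1 → ∀ i ∈ t, ∀ j ∈ t, 0 < f (t.erase i) * f (t.erase j))
    (s t : Finset ι) (hs : s.card = m) (ht : t.card = m) : 0 < f s * f t := by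
  induction hd : (s \ t).card generalizing s with
  | zero =>
    have hst : s = t := Finset.eq_of_subset_of_card_le
      (Finset.sdiff_eq_empty_iff_subset.1 (Finset.card_eq_zero.1 hd)) (by omega)
    rw [hst]
    exact mul_self_pos.2 (hne t ht)
  | succ d ih =>
    obtain ⟨x, hx⟩ : (s \ t).Nonempty := Finset.card_pos.1 (by omega)
    obtain ⟨y, hy⟩ : (t \ s).Nonempty := Finset.card_pos.1 (by
      rw [Finset.card_sdiff_comm (ht.trans hs.symm)]
      omega)
    rw [Finset.mem_sdiff] at hx hy
    have hcard : (insert y s).card = m + 1 := by rw [Finset.card_insert_of_notMem hy.2, hs]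
    have hxm : x ∈ insert y s := Finset.mem_insert_of_mem hx.1
    have hadj := h _ hcard y (Finset.mem_insert_self _ _) x hxm
    rw [Finset.erase_insert hy.2] at hadj
    have hdiff : (insert y s).erase x \ t = (s \ t).erase x := by
      ext z
      simp only [Finset.mem_sdiff, Finset.mem_erase, Finset.mem_insert]
      constructor
      · rintro ⟨⟨hzx, rfl | hz⟩, hzt⟩
        · exact absurd hy.1 hzt
        · exact ⟨hzx, hz, hzt⟩
      · rintro ⟨hzx, hz, hzt⟩
        exact ⟨⟨hzx, Or.inr hz⟩, hzt⟩
    have hrest := ih ((insert y s).erase x)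
      (by rw [Finset.card_erase_of_mem hxm, hcard]; rfl)
      (by rw [hdiff, Finset.card_erase_of_mem (Finset.mem_sdiff.2 hx), hd]; rfl)
    set u := f ((insert y s).erase x)
    have hu : 0 < u * u := mul_self_pos.2 (right_ne_zero_of_mul hadj.ne')
    refine pos_of_mul_pos_left (b := u * u) ?_ hu.le
    calc 0 < (f s * u) * (u * f t) := mul_pos hadj hrest
      _ = f s * f t * (u * u) := by ring

/-- if S⁺XA⁺ or S⁻XA⁻ occurs in the sepr-sequence of a Hermitian matrix,
then X ∈ {A⁺, A⁻}. -/
theorem SXA {n : ℕ} (B : Matrix (Fin n) (Fin n) ℂ) (hB : B.IsHermitian)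
    (k : ℕ) (hk1 : 1 ≤ k) (hk2 : k ≤ n - 2) (ε : ℝ) (hε : ε = 1 ∨ ε = -1)
    (hnonneg : ∀ α : Finset (Fin n), α.card = k → 0 ≤ ε * pminor B α)
    (hzero : ∃ α : Finset (Fin n), α.card = k ∧ pminor B α = 0)
    (hnonzero : ∃ α : Finset (Fin n), α.card = k ∧ pminor B α ≠ 0)
    (hk2' : ∀ β : Finset (Fin n), β.card = k + 2 → 0 < ε * pminor B β) :
    ∃ δ : ℝ, (δ = 1 ∨ δ = -1) ∧
      ∀ γ : Finset (Fin n), γ.card = k + 1 → 0 < δ * pminor B γ := by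
  have hn : k + 2 ≤ n := by omega
  have hadj : ∀ β : Finset (Fin n), β.card = k + 1 + 1 → ∀ i ∈ β, ∀ j ∈ β,
      0 < pminor B (β.erase i) * pminor B (β.erase j) := fun β hβ i hi j hj =>
    pminor_erase_mul_pminor_erase_pos hB hnonneg hβ (hk2' β hβ) hi hj
  have hne : ∀ γ : Finset (Fin n), γ.card = k + 1 → pminor B γ ≠ 0 := by
    intro γ hγ
    obtain ⟨y, hy⟩ : ∃ y, y ∉ γ := by
      by_contra! hall
      have := Finset.card_eq_iff_eq_univ γ |>.2 (Finset.eq_univ_iff_forall.2 hall)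
      rw [Fintype.card_fin] at this
      omega
    have := hadj (insert y γ) (by rw [Finset.card_insert_of_notMem hy, hγ]) y
      (Finset.mem_insert_self _ _) y (Finset.mem_insert_self _ _)
    rw [Finset.erase_insert hy] at this
    exact right_ne_zero_of_mul this.ne'
  have hsign := Finset.mul_pos_of_erase_mul_erase_pos (pminor B) hne hadj
  obtain ⟨γ₀, -, hγ₀⟩ := Finset.exists_subset_card_eq
    (s := (Finset.univ : Finset (Fin n))) (n := k + 1) (by rw [Finset.card_fin]; omega)
  rcases lt_or_gt_of_ne (hne γ₀ hγ₀) with h | h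
  · refine ⟨-1, Or.inr rfl, fun γ hγ => ?_⟩
    have := neg_of_mul_pos_right (hsign γ₀ γ hγ₀ hγ) h.le
    linarith
  · refine ⟨1, Or.inl rfl, fun γ hγ => ?_⟩
    rw [one_mul]
    exact pos_of_mul_pos_right (hsign γ₀ γ hγ₀ hγ) h.le
end

section
/- Let B be an n×n complex Hermitian matrix and let k be an integer with 1 ≤ k ≤ n−1. Suppose every principal minor of B of order k is zero and every principal minor of order k+1 is zero. Then for every j with k ≤ j ≤ n, every principal minor of B of order j is zero. (The NN Theorem: once two consecutive N's occur in the sepr-sequence of a Hermitian matrix, all subsequent terms are N.) -/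
open Polynomial in
/-- Rolle's theorem: the derivative of a real-rooted polynomial is real-rooted. -/
theorem Polynomial.Splits.derivative_real {p : ℝ[X]} (hp : p.Splits) :
    (derivative p).Splits := by
  rw [splits_iff_card_roots] at hp ⊢
  have h₁ := card_roots_le_derivative p
  have h₂ := card_roots' (derivative p)
  have h₃ := natDegree_derivative p
  omega

open Polynomial in
theorem Polynomial.laguerre_X_sub_C_mul (a x : ℝ) (q : ℝ[X]) :
    (derivative ((X - C a) * q)).eval x ^ 2 -
        ((X - C a) * q).eval x * (derivative (derivative ((X - C a) * q))).eval x =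
      q.eval x ^ 2 + (x - a) ^ 2 *
        ((derivative q).eval x ^ 2 - q.eval x * (derivative (derivative q)).eval x) := by
  simp only [derivative_mul, derivative_sub, derivative_X, derivative_C, derivative_add,
    eval_add, eval_mul, eval_sub, eval_X, eval_C, sub_zero, one_mul]
  ring

open Polynomial in
/-- Laguerre's inequality for real-rooted polynomials. -/
theorem Polynomial.Splits.laguerre_nonneg {p : ℝ[X]} (hp : p.Splits) (x : ℝ) :
    0 ≤ (derivative p).eval x ^ 2 - p.eval x * (derivative (derivative p)).eval x := by
  obtain ⟨s, hs⟩ := splits_iff_exists_multiset.mp hp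
  have key : ∀ s : Multiset ℝ, ∀ q : ℝ[X], q = (s.map fun a => X - C a).prod →
      0 ≤ (derivative q).eval x ^ 2 - q.eval x * (derivative (derivative q)).eval x := by
    intro s
    induction s using Multiset.induction with
    | empty => rintro q rfl; simp
    | cons a s ih =>
      rintro q rfl
      rw [Multiset.map_cons, Multiset.prod_cons, laguerre_X_sub_C_mul]
      have := ih _ rfl
      positivity
  have h := mul_nonneg (sq_nonneg p.leadingCoeff) (key s _ rfl)
  rw [hs]
  simp only [derivative_C_mul, eval_mul, eval_C]
  linarith

open Polynomial in
/-- A point where the first two derivatives of a nonconstant real-rooted polynomial vanish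
is a root. -/
theorem Polynomial.Splits.eval_eq_zero_of_derivatives_eq_zero {p : ℝ[X]} (hp : p.Splits)
    (hdeg : 0 < p.natDegree) {x : ℝ} (h₁ : (derivative p).eval x = 0)
    (h₂ : (derivative (derivative p)).eval x = 0) : p.eval x = 0 := by
  have hp0 : p ≠ 0 := by rintro rfl; simp at hdeg
  obtain ⟨a, ha⟩ := hp.exists_eval_eq_zero (natDegree_pos_iff_degree_pos.mp hdeg).ne'
  obtain ⟨q, rfl⟩ := dvd_iff_isRoot.mpr ha
  have hq : q.Splits := hp.of_dvd hp0 (dvd_mul_left _ _)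
  have h := laguerre_X_sub_C_mul a x q
  rw [h₁, h₂] at h
  have hL := mul_nonneg (sq_nonneg (x - a)) (hq.laguerre_nonneg x)
  have hq0 : q.eval x = 0 := by
    have : q.eval x ^ 2 = 0 := le_antisymm (by linarith) (sq_nonneg _)
    simpa using this
  simp [hq0]

open Polynomial in
/-- If two consecutive coefficients below the leading one of a real-rooted polynomial vanish,
then so do all the lower ones. -/
theorem Polynomial.Splits.coeff_eq_zero_of_consecutive {p : ℝ[X]} (hp : p.Splits) {i : ℕ}
    (hdeg : i + 1 < p.natDegree) (h₁ : p.coeff i = 0) (h₂ : p.coeff (i + 1) = 0) :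
    ∀ j ≤ i + 1, p.coeff j = 0 := by
  induction i generalizing p with
  | zero =>
    intro j hj
    interval_cases j <;> assumption
  | succ i ih =>
    have h := ih hp.derivative_real (by rw [natDegree_derivative]; omega)
      (by rw [coeff_derivative, h₁, zero_mul]) (by rw [coeff_derivative, h₂, zero_mul])
    have hpos : ∀ j ≤ i + 1, p.coeff (j + 1) = 0 := fun j hj => by
      have := h j hj
      rw [coeff_derivative] at this
      exact (mul_eq_zero.mp this).resolve_right (by positivity)
    rintro (_ | j) hj
    · rw [coeff_zero_eq_eval_zero]
      apply hp.eval_eq_zero_of_derivatives_eq_zero (by omega)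
      · simp [← coeff_zero_eq_eval_zero, coeff_derivative, hpos 0]
      · simp [← coeff_zero_eq_eval_zero, coeff_derivative, hpos 1]
    · exact hpos j (by omega)

open Polynomial in
theorem Matrix.IsHermitian.exists_real_charpoly {m : Type*} [Fintype m] [DecidableEq m]
    {A : Matrix m m ℂ} (hA : A.IsHermitian) :
    ∃ p : ℝ[X], p.Splits ∧ p.map (algebraMap ℝ ℂ) = A.charpoly := by
  refine ⟨∏ i, (X - C (hA.eigenvalues i)), Splits.prod fun i _ => Splits.X_sub_C _, ?_⟩
  rw [hA.charpoly_eq, Polynomial.map_prod]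
  simp

theorem pminor_submatrix {n : ℕ} (B : Matrix (Fin n) (Fin n) ℂ) (α : Finset (Fin n))
    (s : Finset α) :
    ((B.submatrix (Subtype.val : α → Fin n) Subtype.val).submatrix
      (Subtype.val : s → α) Subtype.val).det.re =
      pminor B (s.map (Function.Embedding.subtype _)) := by
  have h := Matrix.det_submatrix_equiv_self (s.equivMap (Function.Embedding.subtype _))
    (B.submatrix Subtype.val Subtype.val)
  exact congrArg Complex.re h

/-- the NN Theorem: once two consecutive N's occur in the sepr-sequence of a
Hermitian matrix, all subsequent terms are N. -/
theorem NN_theorem {n : ℕ} (B : Matrix (Fin n) (Fin n) ℂ) (hB : B.IsHermitian)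
    (k : ℕ) (hk1 : 1 ≤ k) (hk2 : k ≤ n - 1)
    (h1 : ∀ α : Finset (Fin n), α.card = k → pminor B α = 0)
    (h2 : ∀ α : Finset (Fin n), α.card = k + 1 → pminor B α = 0) :
    ∀ j : ℕ, k ≤ j → j ≤ n → ∀ α : Finset (Fin n), α.card = j → pminor B α = 0 := by
  intro j hkj hjn α hα
  rcases Nat.lt_or_ge j (k + 2) with hj | hj
  · rcases (by omega : j = k ∨ j = k + 1) with rfl | rfl
    · exact h1 α hα
    · exact h2 α hα
  set A : Matrix α α ℂ := fun i j => B i j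
  have hA : A.IsHermitian := hB.submatrix (Subtype.val : α → Fin n)
  obtain ⟨p, hp, hpA⟩ := hA.exists_real_charpoly
  have hcard : Fintype.card α = j := by simp [hα]
  have hdeg : p.natDegree = j := by
    rw [← Polynomial.natDegree_map (algebraMap ℝ ℂ), hpA, A.charpoly_natDegree_eq_dim, hcard]
  have hcoeff : ∀ i, ((p.coeff i : ℝ) : ℂ) = A.charpoly.coeff i := fun i => by
    rw [← hpA, Polynomial.coeff_map]; rfl
  have hzero : ∀ l ≤ j, (∀ β : Finset (Fin n), β.card = l → pminor B β = 0) →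
      p.coeff (j - l) = 0 := by
    intro l hl hβ
    have h := hcoeff (j - l)
    rw [← hcard, A.charpoly_coeff_eq_sum_minors l (by omega), hcard] at h
    have hre := congrArg Complex.re h
    rw [Complex.ofReal_re, show ((-1 : ℂ) ^ l) = (((-1 : ℝ) ^ l : ℝ) : ℂ) by push_cast; rfl,
      Complex.re_ofReal_mul, Complex.re_sum, Finset.sum_eq_zero, mul_zero] at hre
    · exact hre
    · intro s hs
      exact (pminor_submatrix B α s).trans <| hβ _ <| by
        rw [Finset.card_map]
        exact (Finset.mem_powersetCard.mp hs).2
  have h0 : p.coeff 0 = 0 := by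
    refine hp.coeff_eq_zero_of_consecutive (i := j - (k + 1)) (by omega)
      (hzero _ (by omega) h2) ?_ 0 (by omega)
    rw [show j - (k + 1) + 1 = j - k by omega]
    exact hzero _ hkj h1
  change A.det.re = 0
  rw [A.det_eq_sign_charpoly_coeff, ← hcoeff, h0]
  simp
end

section
/- Let B be an invertible n×n complex Hermitian matrix and let k be an integer with 1 ≤ k ≤ n−1. (i) If det B > 0, then for each sign condition s ∈ {positive, negative, zero}: B⁻¹ has a principal minor of order k satisfying s if and only if B has a principal minor of order n−k satisfying s. (ii) If det B < 0, then: B⁻¹ has a positive principal minor of order k if and only if B has a negative principal minor of order n−k; B⁻¹ has a negative principal minor of order k if and only if B has a positive principal minor of order n−k; and B⁻¹ has a zero principal minor of order k if and only if B has a zero principal minor of order n−k. (The Inverse Theorem for sepr-sequences.) -/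
/-- Block form of Jacobi's complementary minor identity. -/
theorem Matrix.det_mul_det_toBlocks₁₁_of_mul_eq_one {l m R : Type*} [Fintype l] [Fintype m]
    [DecidableEq l] [DecidableEq m] [CommRing R] {M N : Matrix (l ⊕ m) (l ⊕ m) R}
    (h : M * N = 1) : M.det * N.toBlocks₁₁.det = M.toBlocks₂₂.det := by
  rw [← fromBlocks_toBlocks M, ← fromBlocks_toBlocks N, fromBlocks_multiply, ← fromBlocks_one,
    fromBlocks_inj] at h
  obtain ⟨h₁, -, h₃, -⟩ := h
  have key : M * fromBlocks N.toBlocks₁₁ 0 N.toBlocks₂₁ 1 =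
      fromBlocks 1 M.toBlocks₁₂ 0 M.toBlocks₂₂ := by
    conv_lhs => rw [← fromBlocks_toBlocks M]
    simp [fromBlocks_multiply, h₁, h₃]
  simpa [det_mul] using congrArg det key

/-- Jacobi's complementary minor identity for principal minors. -/
theorem Matrix.det_mul_det_submatrix_inv {ι R : Type*} [Fintype ι] [DecidableEq ι] [CommRing R]
    (B : Matrix ι ι R) (hB : IsUnit B.det) (α : Finset ι) :
    B.det * det (fun i j : α => B⁻¹ i j) =
      det (fun i j : (αᶜ : Finset ι) => B i j) := by
  let e : α ⊕ (αᶜ : Finset ι) ≃ ι :=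
    ((Equiv.refl _).sumCongr (Equiv.subtypeEquivRight (by simp))).trans
      (Equiv.sumCompl (fun i => i ∈ α))
  have h : B.submatrix e e * B⁻¹.submatrix e e = 1 := by
    rw [submatrix_mul_equiv, mul_nonsing_inv B hB, submatrix_one_equiv]
  have := det_mul_det_toBlocks₁₁_of_mul_eq_one h
  rwa [det_submatrix_equiv_self] at this

theorem pminor_compl {n : ℕ} {B : Matrix (Fin n) (Fin n) ℂ} (hB : B.IsHermitian)
    (hinv : IsUnit B.det) (α : Finset (Fin n)) :
    pminor B αᶜ = B.det.re * pminor B⁻¹ α := by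
  have him : B.det.im = 0 := by
    rw [← Complex.conj_eq_iff_im, starRingEnd_apply, ← Matrix.det_conjTranspose, hB.eq]
  simp [pminor, ← B.det_mul_det_submatrix_inv hinv α, Complex.mul_re, him]

theorem Finset.exists_card_eq_iff_of_compl {ι : Type*} [Fintype ι] [DecidableEq ι] {k : ℕ}
    (hk : k ≤ Fintype.card ι) {P Q : Finset ι → Prop} (h : ∀ α, P α ↔ Q αᶜ) :
    (∃ α : Finset ι, α.card = k ∧ P α) ↔
      ∃ β : Finset ι, β.card = Fintype.card ι - k ∧ Q β := by
  constructor
  · rintro ⟨α, hα, hP⟩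
    exact ⟨αᶜ, by rw [card_compl, hα], (h α).1 hP⟩
  · rintro ⟨β, hβ, hQ⟩
    exact ⟨βᶜ, by rw [card_compl, hβ]; omega, (h _).2 (by rwa [compl_compl])⟩

/-- the Inverse Theorem for sepr-sequences. -/
theorem inverse_theorem {n : ℕ} (B : Matrix (Fin n) (Fin n) ℂ) (hB : B.IsHermitian)
    (hinv : IsUnit B.det) (k : ℕ) (hk1 : 1 ≤ k) (hk2 : k ≤ n - 1) :
    (0 < B.det.re →
      (((∃ α : Finset (Fin n), α.card = k ∧ 0 < pminor B⁻¹ α) ↔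
        (∃ β : Finset (Fin n), β.card = n - k ∧ 0 < pminor B β)) ∧
       ((∃ α : Finset (Fin n), α.card = k ∧ pminor B⁻¹ α < 0) ↔
        (∃ β : Finset (Fin n), β.card = n - k ∧ pminor B β < 0)) ∧
       ((∃ α : Finset (Fin n), α.card = k ∧ pminor B⁻¹ α = 0) ↔
        (∃ β : Finset (Fin n), β.card = n - k ∧ pminor B β = 0)))) ∧
    (B.det.re < 0 →
      (((∃ α : Finset (Fin n), α.card = k ∧ 0 < pminor B⁻¹ α) ↔
        (∃ β : Finset (Fin n), β.card = n - k ∧ pminor B β < 0)) ∧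
       ((∃ α : Finset (Fin n), α.card = k ∧ pminor B⁻¹ α < 0) ↔
        (∃ β : Finset (Fin n), β.card = n - k ∧ 0 < pminor B β)) ∧
       ((∃ α : Finset (Fin n), α.card = k ∧ pminor B⁻¹ α = 0) ↔
        (∃ β : Finset (Fin n), β.card = n - k ∧ pminor B β = 0)))) := by
  have transfer {P Q : ℝ → Prop} (h : ∀ x, P x ↔ Q (B.det.re * x)) :
      (∃ α : Finset (Fin n), α.card = k ∧ P (pminor B⁻¹ α)) ↔
        ∃ β : Finset (Fin n), β.card = n - k ∧ Q (pminor B β) := by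
    have := Finset.exists_card_eq_iff_of_compl (ι := Fin n) (k := k)
      (P := fun α => P (pminor B⁻¹ α)) (Q := fun β => Q (pminor B β))
      (by rw [Fintype.card_fin]; omega) (fun α => by rw [pminor_compl hB hinv, h])
    rwa [Fintype.card_fin] at this
  refine ⟨fun hd => ⟨?_, ?_, ?_⟩, fun hd => ⟨?_, ?_, ?_⟩⟩
  · exact transfer (P := (0 < ·)) (Q := (0 < ·)) fun x => (mul_pos_iff_of_pos_left hd).symm
  · exact transfer (P := (· < 0)) (Q := (· < 0)) fun x => by simp [mul_neg_iff, hd, hd.not_gt]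
  · exact transfer (P := (· = 0)) (Q := (· = 0)) fun x => by simp [hd.ne']
  · exact transfer (P := (0 < ·)) (Q := (· < 0)) fun x => by simp [mul_neg_iff, hd, hd.not_gt]
  · exact transfer (P := (· < 0)) (Q := (0 < ·)) fun x => by simp [mul_pos_iff, hd, hd.not_gt]
  · exact transfer (P := (· = 0)) (Q := (· = 0)) fun x => by simp [hd.ne]
end

section
/- Let B be an n×n complex Hermitian matrix and let k be an integer with 1 ≤ k < n. Suppose every principal minor of B of order k is nonzero and B has both a positive and a negative principal minor of order k. Then there exist a (k−1)-element subset I ⊆ {1,…,n} and distinct indices i, j ∈ {1,…,n} ∖ I such that det B[I ∪ {i}] > 0 and det B[I ∪ {j}] < 0. -/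
/-- If a predicate holds at `s` and fails at a set `t` of the same size, then it holds at some set
of that size and fails at another one obtained from it by exchanging a single element. -/
theorem Finset.exists_exchange_of_card_eq {ι : Type*} [DecidableEq ι] (P : Finset ι → Prop)
    {s t : Finset ι} (hst : s.card = t.card) (hs : P s) (ht : ¬ P t) :
    ∃ (I : Finset ι) (i j : ι), I.card + 1 = s.card ∧ i ∉ I ∧ j ∉ I ∧ i ≠ j ∧
      P (insert i I) ∧ ¬ P (insert j I) := by
  induction h : (t \ s).card generalizing s with
  | zero =>
    have hts : t ⊆ s := by simpa [Finset.sdiff_eq_empty_iff_subset] using h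
    exact absurd (Finset.eq_of_subset_of_card_le hts hst.le ▸ hs) ht
  | succ m ih =>
    obtain ⟨j, hj⟩ : (t \ s).Nonempty := Finset.card_pos.1 (by omega)
    obtain ⟨i, hi⟩ : (s \ t).Nonempty :=
      Finset.card_pos.1 (by rw [Finset.card_sdiff_comm hst]; omega)
    rw [Finset.mem_sdiff] at hi hj
    have hjI : j ∉ s.erase i := fun hmem => hj.2 (Finset.mem_of_mem_erase hmem)
    have hcard := Finset.card_erase_add_one hi.1
    by_cases hP : P (insert j (s.erase i))
    · have hcard' : (insert j (s.erase i)).card = s.card := by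
        rw [Finset.card_insert_of_notMem hjI, hcard]
      have hsdiff : t \ insert j (s.erase i) = (t \ s).erase j := by
        clear ih h hst hcard hcard' ht hs hP
        grind
      have hm : (t \ insert j (s.erase i)).card = m := by
        rw [hsdiff, Finset.card_erase_of_mem (Finset.mem_sdiff.2 hj), h, Nat.add_sub_cancel]
      simpa only [hcard'] using ih (hcard'.trans hst) hP hm
    · exact ⟨s.erase i, i, j, hcard, Finset.notMem_erase i s, hjI,
        fun hij => hj.2 (hij ▸ hi.1), by rwa [Finset.insert_erase hi.1], hP⟩

/-- if the k-th term of the sepr-sequence of a Hermitian matrix is A*, then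
there are order-k principal minors of opposite signs whose index sets differ in one element. -/
theorem Astar_lemma {n : ℕ} (B : Matrix (Fin n) (Fin n) ℂ) (hB : B.IsHermitian)
    (k : ℕ) (hk1 : 1 ≤ k) (hk2 : k < n)
    (hall : ∀ α : Finset (Fin n), α.card = k → pminor B α ≠ 0)
    (hpos : ∃ α : Finset (Fin n), α.card = k ∧ 0 < pminor B α)
    (hneg : ∃ α : Finset (Fin n), α.card = k ∧ pminor B α < 0) :
    ∃ I : Finset (Fin n), I.card = k - 1 ∧ ∃ i j : Fin n, i ∉ I ∧ j ∉ I ∧ i ≠ j ∧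
      0 < pminor B (insert i I) ∧ pminor B (insert j I) < 0 := by
  obtain ⟨s, hs, hs'⟩ := hpos
  obtain ⟨t, ht, ht'⟩ := hneg
  obtain ⟨I, i, j, hI, hi, hj, hij, hPi, hPj⟩ := Finset.exists_exchange_of_card_eq
    (fun α => 0 < pminor B α) (hs.trans ht.symm) hs' ht'.not_gt
  refine ⟨I, by omega, i, j, hi, hj, hij, hPi, lt_of_le_of_ne (not_lt.1 hPj) (hall _ ?_)⟩
  rw [Finset.card_insert_of_notMem hj, hI, hs]
end

section
/- Let B be an n×n complex Hermitian matrix with rank r ≥ 1. Then all nonzero principal minors of B of order r have the same sign; that is, for any two subsets α, β ⊆ {1,…,n} of size r with det B[α] ≠ 0 and det B[β] ≠ 0, one has det B[α] · det B[β] > 0. -/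
open Matrix in
/-- If a square submatrix of `B` whose size is the rank of `B` is invertible, then the columns of `B`
it meets span the column space of `B`. -/
theorem Matrix.exists_eq_submatrix_mul_of_isUnit_det {K m n k : Type*} [Field K] [Fintype m]
    [Fintype n] [Fintype k] [DecidableEq k] (B : Matrix m n K) (f : k → m) (g : k → n)
    (hdet : IsUnit (B.submatrix f g).det) (hrank : B.rank = Fintype.card k) :
    ∃ Q : Matrix k n K, B = B.submatrix id g * Q := by
  classical
  have hle : LinearMap.range (B.submatrix id g).mulVecLin ≤ LinearMap.range B.mulVecLin := by
    rw [range_mulVecLin, range_mulVecLin]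
    refine Submodule.span_mono ?_
    rintro _ ⟨j, rfl⟩
    exact ⟨g j, rfl⟩
  have hsub : Fintype.card k ≤ (B.submatrix id g).rank := by
    rw [← rank_of_isUnit _ ((isUnit_iff_isUnit_det _).2 hdet)]
    exact rank_submatrix_le (B.submatrix id g) f id
  have heq := Submodule.eq_of_le_of_finrank_le hle (hrank.trans_le hsub)
  have hcol (j : n) : ∃ q : k → K, B.submatrix id g *ᵥ q = B.col j := by
    have hj : B.col j ∈ LinearMap.range B.mulVecLin := ⟨Pi.single j 1, by simp⟩
    rwa [← heq] at hj
  choose q hq using hcol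
  refine ⟨(of q)ᵀ, ?_⟩
  ext i j
  exact (congrFun (hq j) i).symm

open Matrix in
/-- A Hermitian matrix is congruent, via a rectangular matrix, to any invertible principal submatrix
whose size is its rank. -/
theorem Matrix.IsHermitian.exists_eq_conjTranspose_mul_submatrix_mul {K n k : Type*} [Field K]
    [StarRing K] [Fintype n] [Fintype k] [DecidableEq k] {B : Matrix n n K} (hB : B.IsHermitian)
    (f : k → n) (hdet : IsUnit (B.submatrix f f).det) (hrank : B.rank = Fintype.card k) :
    ∃ Q : Matrix k n K, B = Qᴴ * B.submatrix f f * Q := by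
  obtain ⟨Q, hQ⟩ := B.exists_eq_submatrix_mul_of_isUnit_det f f hdet hrank
  refine ⟨Q, ?_⟩
  have hrow : B = Qᴴ * B.submatrix f id := by
    have h : Bᴴ = (B.submatrix id f * Q)ᴴ := congrArg _ hQ
    rwa [conjTranspose_mul, conjTranspose_submatrix, hB.eq] at h
  have hC : B.submatrix id f = Qᴴ * B.submatrix f f := by
    ext i j
    exact congrFun (congrFun hrow i) (f j)
  rwa [hC] at hQ

open Matrix in
/-- The determinant of any principal submatrix of rank size is that of an invertible one
times a factor of the form `star d * d`. -/
theorem Matrix.IsHermitian.exists_det_submatrix_eq {K n k : Type*} [Field K]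
    [StarRing K] [Fintype n] [Fintype k] [DecidableEq k] {B : Matrix n n K} (hB : B.IsHermitian)
    (f g : k → n) (hdet : (B.submatrix f f).det ≠ 0) (hrank : B.rank = Fintype.card k) :
    ∃ d : K, (B.submatrix g g).det = star d * d * (B.submatrix f f).det := by
  obtain ⟨Q, hQ⟩ := hB.exists_eq_conjTranspose_mul_submatrix_mul f hdet.isUnit hrank
  refine ⟨(Q.submatrix id g).det, ?_⟩
  have hg : B.submatrix g g = (Q.submatrix id g)ᴴ * B.submatrix f f * Q.submatrix id g := by
    ext i j
    exact congrFun (congrFun hQ (g i)) (g j)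
  rw [hg, det_mul, det_mul, det_conjTranspose]
  ring

/-- all nonzero principal minors of order rank(B) of a Hermitian matrix have
the same sign. -/
theorem same_sign_rank_minors {n : ℕ} (B : Matrix (Fin n) (Fin n) ℂ) (hB : B.IsHermitian)
    (r : ℕ) (hr : 1 ≤ r) (hrank : B.rank = r) :
    ∀ α β : Finset (Fin n), α.card = r → β.card = r →
      pminor B α ≠ 0 → pminor B β ≠ 0 → 0 < pminor B α * pminor B β := by
  intro α β hα hβ hminα hminβ
  let e : α ≃ β := Finset.equivOfCardEq (hα.trans hβ.symm)
  have hdet : (B.submatrix (fun i : α => (i : Fin n)) (fun i : α => (i : Fin n))).det ≠ 0 :=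
    fun h => hminα ((congrArg Complex.re h).trans Complex.zero_re)
  obtain ⟨d, hd⟩ := hB.exists_det_submatrix_eq (fun i : α => (i : Fin n))
    (fun i : α => (e i : Fin n)) hdet (by rw [hrank, Fintype.card_coe, hα])
  have hβα : pminor B β = Complex.normSq d * pminor B α := by
    have h := (Matrix.det_submatrix_equiv_self e (fun i j : β => B i j)).symm.trans hd
    rw [Complex.star_def, ← Complex.normSq_eq_conj_mul_self] at h
    exact (congrArg Complex.re h).trans (Complex.re_ofReal_mul _ _)
  have hd0 : 0 < Complex.normSq d :=
    (Complex.normSq_nonneg d).lt_of_ne fun h => hminβ (by rw [hβα, ← h, zero_mul])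
  rw [hβα, mul_left_comm]
  exact mul_pos hd0 (mul_self_pos.2 hminα)
end

section
/- Let B be an n×n complex Hermitian matrix and let k be an integer with 1 ≤ k ≤ n−2. Suppose every principal minor of B of order k+1 is zero and every principal minor of order k+2 is zero. Then B cannot have both a positive and a negative principal minor of order k. (Equivalently, neither A*NN nor S*NN can occur as a subsequence of the sepr-sequence of a Hermitian matrix.) -/
open Matrix

theorem Matrix.IsHermitian.ofReal_re_det {ι : Type*} [Fintype ι] [DecidableEq ι]
    {A : Matrix ι ι ℂ} (hA : A.IsHermitian) : ((A.det.re : ℝ) : ℂ) = A.det := by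
  apply Complex.conj_eq_iff_re.mp
  rw [starRingEnd_apply, ← det_conjTranspose, hA.eq]

theorem pminor_image {n : ℕ} (B : Matrix (Fin n) (Fin n) ℂ) {ι : Type*} [Fintype ι]
    [DecidableEq ι] {f : ι → Fin n} (hf : Function.Injective f) :
    pminor B (Finset.univ.image f) = (B.submatrix f f).det.re := by
  let e : ι ≃ (Finset.univ.image f : Finset (Fin n)) :=
    Equiv.ofBijective (fun i => ⟨f i, Finset.mem_image_of_mem f (Finset.mem_univ i)⟩)
      ⟨fun i j h => hf (congrArg Subtype.val h), fun x => by
        obtain ⟨i, -, hi⟩ := Finset.mem_image.mp x.2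
        exact ⟨i, Subtype.ext hi⟩⟩
  have h := det_submatrix_equiv_self e (B.submatrix Subtype.val Subtype.val)
  exact congrArg Complex.re h.symm

/-- If all principal minors of order `m` vanish, then so do the determinants of all matrices
obtained by choosing `m` indices, possibly with repetitions. -/
theorem det_submatrix_eq_zero_of_pminor {n m : ℕ} {B : Matrix (Fin n) (Fin n) ℂ}
    (hB : B.IsHermitian) (h : ∀ α : Finset (Fin n), α.card = m → pminor B α = 0)
    {ι : Type*} [Fintype ι] [DecidableEq ι] (hι : Fintype.card ι = m) (f : ι → Fin n) :
    (B.submatrix f f).det = 0 := by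
  by_cases hf : Function.Injective f
  · rw [← (hB.submatrix f).ofReal_re_det, ← pminor_image B hf, h, Complex.ofReal_zero]
    rw [Finset.card_image_of_injective _ hf, Finset.card_univ, hι]
  · simp only [Function.Injective, not_forall] at hf
    obtain ⟨i, j, hij, hne⟩ := hf
    exact det_zero_of_row_eq hne (by ext l; simp [hij])

theorem det_submatrix_sumElim {κ ι μ : Type*} [Fintype ι] [DecidableEq ι] [Fintype μ]
    [DecidableEq μ] (B : Matrix κ κ ℂ) (a : ι → κ) (g : μ → κ)
    (ha : (B.submatrix a a).det ≠ 0) :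
    (B.submatrix (Sum.elim a g) (Sum.elim a g)).det = (B.submatrix a a).det *
      ((B - B.submatrix id a * (B.submatrix a a)⁻¹ * B.submatrix a id).submatrix g g).det := by
  have : Invertible (B.submatrix a a) := invertibleOfIsUnitDet _ (isUnit_iff_ne_zero.mpr ha)
  have hblocks : B.submatrix (Sum.elim a g) (Sum.elim a g) =
      fromBlocks (B.submatrix a a) (B.submatrix a g) (B.submatrix g a) (B.submatrix g g) := by
    ext (i | i) (j | j) <;> rfl
  rw [hblocks, det_fromBlocks₁₁, invOf_eq_nonsing_inv]
  rfl

theorem Matrix.IsHermitian.eq_zero_of_minors {κ : Type*} {S : Matrix κ κ ℂ}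
    (hS : S.IsHermitian) (h1 : ∀ g : Fin 1 → κ, (S.submatrix g g).det = 0)
    (h2 : ∀ g : Fin 2 → κ, (S.submatrix g g).det = 0) : S = 0 := by
  have hdiag (i : κ) : S i i = 0 := by simpa using h1 fun _ => i
  ext i j
  have h := h2 ![i, j]
  rw [det_fin_two] at h
  simpa [hdiag, ← hS.apply j i] using h

/-- The Schur complement of a nonsingular principal submatrix of order `k` vanishes if all
principal minors of orders `k + 1` and `k + 2` do. -/
theorem eq_mul_inv_mul_of_pminor {n k : ℕ} {B : Matrix (Fin n) (Fin n) ℂ}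
    (hB : B.IsHermitian)
    (h1 : ∀ α : Finset (Fin n), α.card = k + 1 → pminor B α = 0)
    (h2 : ∀ α : Finset (Fin n), α.card = k + 2 → pminor B α = 0)
    {ι : Type*} [Fintype ι] [DecidableEq ι] (hι : Fintype.card ι = k) (a : ι → Fin n)
    (ha : (B.submatrix a a).det ≠ 0) :
    B = B.submatrix id a * (B.submatrix a a)⁻¹ * B.submatrix a id := by
  rw [← sub_eq_zero]
  refine IsHermitian.eq_zero_of_minors (hB.sub ?_) (fun g => ?_) fun g => ?_
  · have h := isHermitian_conjTranspose_mul_mul (B.submatrix a id) (hB.submatrix a).inv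
    rwa [conjTranspose_submatrix, hB.eq] at h
  · have h := det_submatrix_eq_zero_of_pminor hB h1 (by simp [hι]) (Sum.elim a g)
    rw [det_submatrix_sumElim B a g ha] at h
    exact (mul_eq_zero.mp h).resolve_left ha
  · have h := det_submatrix_eq_zero_of_pminor hB h2 (by simp [hι]) (Sum.elim a g)
    rw [det_submatrix_sumElim B a g ha] at h
    exact (mul_eq_zero.mp h).resolve_left ha

/-- neither A*NN nor S*NN can occur as a subsequence of the sepr-sequence of a
Hermitian matrix. -/
theorem no_starNN {n : ℕ} (B : Matrix (Fin n) (Fin n) ℂ) (hB : B.IsHermitian)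
    (k : ℕ) (hk1 : 1 ≤ k) (hk2 : k ≤ n - 2)
    (h1 : ∀ α : Finset (Fin n), α.card = k + 1 → pminor B α = 0)
    (h2 : ∀ α : Finset (Fin n), α.card = k + 2 → pminor B α = 0) :
    ¬ ((∃ α : Finset (Fin n), α.card = k ∧ 0 < pminor B α) ∧
       (∃ β : Finset (Fin n), β.card = k ∧ pminor B β < 0)) := by
  rintro ⟨⟨α, hα, hpos⟩, β, hβ, hneg⟩
  let a : α → Fin n := Subtype.val
  let b : α → Fin n := Subtype.val ∘ Finset.equivOfCardEq (hα.trans hβ.symm)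
  have hdetα : ((pminor B α : ℝ) : ℂ) = (B.submatrix a a).det :=
    (hB.submatrix a).ofReal_re_det
  have hdetβ : ((pminor B β : ℝ) : ℂ) = (B.submatrix b b).det := by
    refine ((hB.submatrix (Subtype.val : β → Fin n)).ofReal_re_det).trans ?_
    rw [← det_submatrix_equiv_self (Finset.equivOfCardEq (hα.trans hβ.symm))]
    rfl
  have ha : (B.submatrix a a).det ≠ 0 := by
    rw [← hdetα]
    exact_mod_cast hpos.ne'
  have hfactor : B.submatrix b b =
      (B.submatrix a b)ᴴ * (B.submatrix a a)⁻¹ * B.submatrix a b := by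
    rw [conjTranspose_submatrix, hB.eq]
    exact congrArg (fun M => M.submatrix b b)
      (eq_mul_inv_mul_of_pminor hB h1 h2 (by simpa using hα) a ha)
  have hdet : pminor B α * pminor B β = Complex.normSq (B.submatrix a b).det := by
    apply Complex.ofReal_injective
    push_cast
    rw [hdetα, hdetβ, hfactor, det_mul, det_mul, det_conjTranspose, det_nonsing_inv,
      Ring.inverse_eq_inv', Complex.normSq_eq_conj_mul_self, starRingEnd_apply]
    field_simp
  exact (mul_neg_of_pos_of_neg hpos hneg).not_ge (hdet ▸ Complex.normSq_nonneg _)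
end

section
/- Let n ≥ 2 and let B = [b_{ij}] be an n×n complex Hermitian matrix such that b_{ii} = 0 for some index i and every principal minor of B of order 2 is nonnegative. Then every entry of row i of B is zero; consequently, for every m with 1 ≤ m ≤ n, B has a zero principal minor of order m (so B is singular, and no Hermitian matrix has sepr-sequence S⁺S⁺⋯X⋯ or S⁻S⁺⋯X⋯ with X ∈ {A*, A⁺, A⁻}). -/
/-- The principal minor of order 2 on `{i, j}` is the usual 2×2 determinant. -/
theorem pminor_pair {n : ℕ} (B : Matrix (Fin n) (Fin n) ℂ) {i j : Fin n} (hij : i ≠ j) :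
    pminor B {i, j} = (B i i * B j j - B i j * B j i).re := by
  let f : Fin 2 → ({i, j} : Finset (Fin n)) := ![⟨i, by simp⟩, ⟨j, by simp⟩]
  have hf : Function.Bijective f := by
    rw [Fintype.bijective_iff_injective_and_card]
    refine ⟨?_, by rw [Fintype.card_coe, Finset.card_pair hij, Fintype.card_fin]⟩
    intro a b hab
    fin_cases a <;> fin_cases b <;> simp_all [f, hij.symm]
  change (Matrix.det (B.submatrix Subtype.val Subtype.val)).re = _
  rw [← Matrix.det_submatrix_equiv_self (Equiv.ofBijective f hf), Matrix.det_fin_two]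
  simp [f]

/-- A principal minor vanishes if its index set contains the index of a zero row. -/
theorem pminor_eq_zero_of_row_eq_zero {n : ℕ} (B : Matrix (Fin n) (Fin n) ℂ) {i : Fin n}
    (hrow : ∀ j, B i j = 0) {α : Finset (Fin n)} (hi : i ∈ α) : pminor B α = 0 := by
  change (Matrix.det (B.submatrix Subtype.val Subtype.val)).re = 0
  rw [Matrix.det_eq_zero_of_row_eq_zero (⟨i, hi⟩ : α) fun j => hrow j, Complex.zero_re]

/-- a Hermitian matrix with a zero diagonal entry and all order-2 principal
minors nonnegative has the corresponding row zero; hence it has a zero principal minor of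
every order. -/
theorem zero_diag_row_zero {n : ℕ} (hn : 2 ≤ n) (B : Matrix (Fin n) (Fin n) ℂ)
    (hB : B.IsHermitian) (i : Fin n) (hi : B i i = 0)
    (h2 : ∀ α : Finset (Fin n), α.card = 2 → 0 ≤ pminor B α) :
    (∀ j : Fin n, B i j = 0) ∧
    (∀ m : ℕ, 1 ≤ m → m ≤ n → ∃ α : Finset (Fin n), α.card = m ∧ pminor B α = 0) := by
  have hrow : ∀ j, B i j = 0 := by
    intro j
    rcases eq_or_ne i j with rfl | hij
    · exact hi
    have h := h2 {i, j} (Finset.card_pair hij)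
    rw [pminor_pair B hij, hi, ← hB.apply j i, Complex.star_def, Complex.mul_conj] at h
    have h' : Complex.normSq (B i j) ≤ 0 := by simpa using h
    exact Complex.normSq_eq_zero.mp (h'.antisymm (Complex.normSq_nonneg _))
  refine ⟨hrow, fun m hm hmn => ?_⟩
  obtain ⟨α, hα, -, hcard⟩ := Finset.exists_subsuperset_card_eq
    (Finset.subset_univ ({i} : Finset (Fin n))) (by simpa using hm) (by simpa using hmn)
  exact ⟨α, hcard, pminor_eq_zero_of_row_eq_zero B hrow (hα (Finset.mem_singleton_self i))⟩
end

section
/- Let B be an n×n complex Hermitian matrix and let k be an integer with 1 ≤ k and k+2 ≤ n. Suppose: every principal minor of order k is nonzero; every principal minor of order k+1 is zero; and B has both a zero and a nonzero principal minor of order k+2. Then either (every principal minor of order k is positive and every nonzero principal minor of order k+2 is negative) or (every principal minor of order k is negative and every nonzero principal minor of order k+2 is positive). (If the epr-sequence contains ANS at positions k, k+1, k+2, then the sepr-sequence there is A⁺NS⁻ or A⁻NS⁺.) -/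
namespace Matrix

/-- The **Desnanot–Jacobi identity** for a principal pair of indices. -/
theorem det_mul_det_updateRow_updateRow {m R : Type*} [Fintype m] [DecidableEq m] [CommRing R]
    (A : Matrix m m R) {i j : m} (hij : i ≠ j) :
    A.det * ((A.updateRow i (Pi.single i 1)).updateRow j (Pi.single j 1)).det =
      A.adjugate i i * A.adjugate j j - A.adjugate i j * A.adjugate j i := by
  set A' := A.updateRow i (Pi.single i 1) with hA'
  have hrow : A.det • (Pi.single j 1 : m → R) =
      (∑ k, A.adjugate j k • A' k) + A.adjugate j i • (A i - Pi.single i 1) := by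
    have h1 : A.det • (Pi.single j 1 : m → R) = ∑ k, A.adjugate j k • A k := by
      ext l
      have := congrFun (congrFun (adjugate_mul A) j) l
      simp only [mul_apply, smul_apply, one_apply, smul_eq_mul] at this
      simp [Finset.sum_apply, this, Pi.single_apply, eq_comm]
    have h2 : ∀ k, A.adjugate j k • A k =
        A.adjugate j k • A' k + if k = i then A.adjugate j i • (A i - Pi.single i 1) else 0 := by
      intro k
      by_cases hk : k = i
      · subst hk
        simp [hA', smul_sub]
      · simp [hA', hk]
    rw [h1, Finset.sum_congr rfl fun k _ => h2 k, Finset.sum_add_distrib]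
    simp
  have hzero : (A'.updateRow j (Pi.single i 1)).det = 0 := by
    apply det_zero_of_row_eq hij
    simp [hA', updateRow_ne hij]
  have hswap : (A'.updateRow j (A i)).det = -A.adjugate i j := by
    have h : A'.updateRow j (A i) =
        (A.updateRow j (Pi.single i 1)).submatrix (Equiv.swap i j) id := by
      ext a b
      rcases eq_or_ne a j with rfl | haj
      · simp [updateRow_ne hij]
      rcases eq_or_ne a i with rfl | hai
      · simp [hA', updateRow_ne hij]
      · simp [hA', updateRow_ne haj, updateRow_ne hai, Equiv.swap_apply_of_ne_of_ne hai haj]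
    rw [h, det_permute, Equiv.Perm.sign_swap hij, adjugate_apply]
    simp
  have hneg : (A'.updateRow j (A i - Pi.single i 1)).det = -A.adjugate i j := by
    have h := det_updateRow_add A' j (A i - Pi.single i 1) (Pi.single i 1)
    rw [sub_add_cancel, hswap, hzero, add_zero] at h
    exact h.symm
  rw [← det_updateRow_smul, hrow, det_updateRow_add, det_updateRow_sum, det_updateRow_smul, hneg,
    adjugate_apply A i i]
  simp only [smul_eq_mul]
  ring

/-- If the rows of `A` outside `s` are those of the identity matrix, then `det A` is the principal
minor of `A` indexed by `s`. -/
theorem det_eq_det_subtype_of_row_eq_single {m R : Type*} [Fintype m] [DecidableEq m]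
    [CommRing R] (A : Matrix m m R) (s : Finset m) (h : ∀ i ∉ s, A i = Pi.single i 1) :
    A.det = det (fun i j : s => A i j) := by
  have h1 := twoBlockTriangular_det A (fun i => i ∈ s) fun i hi j hj => by
    rw [h i hi, Pi.single_eq_of_ne]
    rintro rfl
    exact hi hj
  have h2 : toSquareBlockProp A (fun i => i ∉ s) = 1 := by
    ext i j
    simp [toSquareBlockProp, h i i.2, one_apply, Pi.single_apply, Subtype.ext_iff, eq_comm]
  rw [h2, det_one, mul_one] at h1
  rw [h1]
  exact congrArg (fun inst => @det s _ inst R _ (fun i j : s => A i j)) (Subsingleton.elim _ _)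

/-- The principal submatrix of `B` indexed by `s`, extended by the identity outside `s`. -/
def principalExtend {m R : Type*} [DecidableEq m] [Zero R] [One R] (B : Matrix m m R)
    (s : Finset m) : Matrix m m R :=
  fun i j => if i ∈ s ∧ j ∈ s then B i j else (1 : Matrix m m R) i j

theorem principalExtend_of_notMem {m R : Type*} [DecidableEq m] [Zero R] [One R]
    (B : Matrix m m R) (s : Finset m) {i : m} (hi : i ∉ s) :
    principalExtend B s i = Pi.single i 1 := by
  ext j
  simp [principalExtend, hi, one_apply, Pi.single_apply, eq_comm]

theorem IsHermitian.principalExtend {m R : Type*} [DecidableEq m] [CommRing R] [StarRing R]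
    {B : Matrix m m R} (hB : B.IsHermitian) (s : Finset m) :
    (B.principalExtend s).IsHermitian := by
  ext i j
  have h1 := congrFun (congrFun (isHermitian_one (n := m) (α := R)) i) j
  have h2 := hB.apply i j
  simp only [conjTranspose_apply] at h1
  simp only [conjTranspose_apply, Matrix.principalExtend, and_comm (a := j ∈ s)]
  split_ifs <;> assumption

end Matrix

open Matrix in
theorem pminor_eq_re_det {n : ℕ} (B A : Matrix (Fin n) (Fin n) ℂ) (s : Finset (Fin n))
    (hs : ∀ i ∈ s, ∀ j ∈ s, A i j = B i j) (h : ∀ i ∉ s, A i = Pi.single i 1) :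
    pminor B s = A.det.re := by
  rw [det_eq_det_subtype_of_row_eq_single A s h, pminor]
  congr 3
  ext i j
  exact (hs i i.2 j j.2).symm

open Matrix in
theorem pminor_erase_mul_pminor_erase {n : ℕ} (B : Matrix (Fin n) (Fin n) ℂ) (hB : B.IsHermitian)
    (s : Finset (Fin n)) {i j : Fin n} (hij : i ≠ j) :
    pminor B s * pminor B ((s.erase i).erase j) ≤ pminor B (s.erase i) * pminor B (s.erase j) := by
  set A := B.principalExtend s with hA
  have hAB : ∀ a ∈ s, ∀ b ∈ s, A a b = B a b := fun a ha b hb => by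
    simp [hA, principalExtend, ha, hb]
  have hA1 : ∀ a ∉ s, A a = Pi.single a 1 := fun a ha => principalExtend_of_notMem B s ha
  have hH : A.IsHermitian := hB.principalExtend s
  have herase : ∀ t : Fin n, pminor B (s.erase t) = (A.adjugate t t).re := by
    intro t
    rw [adjugate_apply]
    apply pminor_eq_re_det
    · intro a ha b hb
      rw [Finset.mem_erase] at ha hb
      rw [updateRow_ne ha.1, hAB a ha.2 b hb.2]
    · intro a ha
      rcases eq_or_ne a t with rfl | hat
      · exact updateRow_self
      · rw [updateRow_ne hat]
        exact hA1 a fun h => ha (Finset.mem_erase.2 ⟨hat, h⟩)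
  have herase₂ : pminor B ((s.erase i).erase j) =
      ((A.updateRow i (Pi.single i 1)).updateRow j (Pi.single j 1)).det.re := by
    apply pminor_eq_re_det
    · intro a ha b hb
      simp only [Finset.mem_erase] at ha hb
      rw [updateRow_ne ha.1, updateRow_ne ha.2.1, hAB a ha.2.2 b hb.2.2]
    · intro a ha
      rcases eq_or_ne a j with rfl | haj
      · exact updateRow_self
      rw [updateRow_ne haj]
      rcases eq_or_ne a i with rfl | hai
      · exact updateRow_self
      · rw [updateRow_ne hai]
        exact hA1 a fun h => ha (by simp [haj, hai, h])
  have hdet : A.det.im = 0 := by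
    have h := det_conjTranspose A
    rw [hH.eq] at h
    exact Complex.conj_eq_iff_im.1 h.symm
  have hadj : ∀ a b, star (A.adjugate b a) = A.adjugate a b := fun a b => hH.adjugate.apply a b
  have him : (A.adjugate i i).im = 0 := Complex.conj_eq_iff_im.1 (hadj i i)
  have key := congrArg Complex.re (det_mul_det_updateRow_updateRow A hij)
  rw [← hadj j i] at key
  simp only [Complex.mul_re, Complex.sub_re, Complex.star_def, Complex.conj_re, Complex.conj_im,
    hdet, him] at key
  rw [pminor_eq_re_det B A s hAB hA1, herase, herase, herase₂]
  nlinarith [sq_nonneg (A.adjugate i j).re, sq_nonneg (A.adjugate i j).im]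

theorem pminor_mul_pos_of_card_eq {n : ℕ} (B : Matrix (Fin n) (Fin n) ℂ) (hB : B.IsHermitian)
    (k : ℕ) (hA : ∀ α : Finset (Fin n), α.card = k → pminor B α ≠ 0)
    (hN : ∀ α : Finset (Fin n), α.card = k + 1 → pminor B α = 0)
    (α α' : Finset (Fin n)) (hα : α.card = k) (hα' : α'.card = k) :
    0 < pminor B α * pminor B α' := by
  induction hd : (α' \ α).card generalizing α with
  | zero =>
    have hsub : α' ⊆ α := Finset.sdiff_eq_empty_iff_subset.1 (Finset.card_eq_zero.1 hd)
    obtain rfl := Finset.eq_of_subset_of_card_le hsub (by lia)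
    exact mul_self_pos.2 (hA _ hα)
  | succ d ih =>
    obtain ⟨j, hj⟩ : (α' \ α).Nonempty := Finset.card_pos.1 (by lia)
    obtain ⟨i, hi⟩ : (α \ α').Nonempty := Finset.card_pos.1 (by
      rw [Finset.card_sdiff_comm (hα.trans hα'.symm)]
      lia)
    rw [Finset.mem_sdiff] at hi hj
    have hij : i ≠ j := fun h => hj.2 (h ▸ hi.1)
    have hcard : (insert j α).card = k + 1 := by rw [Finset.card_insert_of_notMem hj.2, hα]
    have hcard' : ((insert j α).erase i).card = k := by
      rw [Finset.card_erase_of_mem (Finset.mem_insert_of_mem hi.1), hcard, Nat.add_sub_cancel]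
    have hstep := pminor_erase_mul_pminor_erase B hB (insert j α) hij
    rw [hN _ hcard, zero_mul, Finset.erase_insert hj.2] at hstep
    have hrest := ih _ hcard' (by
      have : α' \ (insert j α).erase i = (α' \ α).erase j := by
        ext a
        simp only [Finset.mem_sdiff, Finset.mem_erase, Finset.mem_insert]
        grind
      rw [this, Finset.card_erase_of_mem (Finset.mem_sdiff.2 hj), hd, Nat.add_sub_cancel])
    have hpos := lt_of_le_of_ne hstep (mul_ne_zero (hA _ hcard') (hA _ hα)).symm
    have hsq := mul_self_pos.2 (hA _ hcard')
    have hprod := mul_pos hpos hrest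
    refine pos_of_mul_pos_right (a := pminor B ((insert j α).erase i) *
      pminor B ((insert j α).erase i)) ?_ hsq.le
    linarith

/-- if the epr-sequence of a Hermitian matrix contains ANS at positions
k, k+1, k+2, then the sepr-sequence there is A⁺NS⁻ or A⁻NS⁺. -/
theorem ANS_signs {n : ℕ} (B : Matrix (Fin n) (Fin n) ℂ) (hB : B.IsHermitian)
    (k : ℕ) (hk1 : 1 ≤ k) (hk2 : k + 2 ≤ n)
    (hA : ∀ α : Finset (Fin n), α.card = k → pminor B α ≠ 0)
    (hN : ∀ α : Finset (Fin n), α.card = k + 1 → pminor B α = 0)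
    (hzero : ∃ β : Finset (Fin n), β.card = k + 2 ∧ pminor B β = 0)
    (hnonzero : ∃ β : Finset (Fin n), β.card = k + 2 ∧ pminor B β ≠ 0) :
    ((∀ α : Finset (Fin n), α.card = k → 0 < pminor B α) ∧
     (∀ β : Finset (Fin n), β.card = k + 2 → pminor B β ≠ 0 → pminor B β < 0)) ∨
    ((∀ α : Finset (Fin n), α.card = k → pminor B α < 0) ∧
     (∀ β : Finset (Fin n), β.card = k + 2 → pminor B β ≠ 0 → 0 < pminor B β)) := by
  have hlow := pminor_mul_pos_of_card_eq B hB k hA hN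
  have hhigh : ∀ β : Finset (Fin n), β.card = k + 2 →
      ∃ α : Finset (Fin n), α.card = k ∧ pminor B β * pminor B α ≤ 0 := by
    intro β hβ
    obtain ⟨i, hi, j, hj, hij⟩ := Finset.one_lt_card.1 (show 1 < β.card by lia)
    have hi1 : (β.erase i).card = k + 1 := by
      rw [Finset.card_erase_of_mem hi, hβ]
      lia
    refine ⟨(β.erase i).erase j, ?_, ?_⟩
    · rw [Finset.card_erase_of_mem (Finset.mem_erase.2 ⟨hij.symm, hj⟩), hi1, Nat.add_sub_cancel]
    · have h := pminor_erase_mul_pminor_erase B hB β hij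
      rwa [hN _ hi1, zero_mul] at h
  obtain ⟨β, hβ, -⟩ := hnonzero
  obtain ⟨α₀, hα₀, -⟩ := hhigh β hβ
  rcases (hA α₀ hα₀).lt_or_gt with h0 | h0
  · have hneg : ∀ α : Finset (Fin n), α.card = k → pminor B α < 0 := fun α hα =>
      (neg_iff_neg_of_mul_pos (hlow α₀ α hα₀ hα)).1 h0
    refine Or.inr ⟨hneg, fun β hβ hne => ?_⟩
    obtain ⟨α, hα, hle⟩ := hhigh β hβ
    exact lt_of_le_of_ne (by nlinarith [hneg α hα]) hne.symm
  · have hpos : ∀ α : Finset (Fin n), α.card = k → 0 < pminor B α := fun α hα =>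
      (pos_iff_pos_of_mul_pos (hlow α₀ α hα₀ hα)).1 h0
    refine Or.inl ⟨hpos, fun β hβ hne => ?_⟩
    obtain ⟨α, hα, hle⟩ := hhigh β hβ
    exact lt_of_le_of_ne (by nlinarith [hpos α hα]) hne
end
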